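/- arXiv:math/0312323 — 6 statements merged into one kernel-verified Lean document; each statement's English description precedes it below -/
import Mathlib

section
/- Let n ≥ 2. There exist constants A(n) and B(n), depending only on n, with the following property. Let H = y² − x^{n+1} + H̄(x) be a hyperelliptic polynomial of Morse type with H̄ ∈ ℂ[x] of degree ≤ n−1, let ω = P dx + Q dy be a polynomial 1-form of weighted degree ≤ d, let t_0 be a regular value of H, and let δ = (δ_x, δ_y) : U × ℝ → ℂ² be a continuous family of loops in the fibres of H over an open connected neighbourhood U of t_0 consisting of regular values (δ continuous, 1-periodic in s, continuously differentiable in s with jointly continuous s-derivative, and H(δ(t,s)) = t). Define I(t) = ∫₀¹ [ P(δ(t,s))·∂_s δ_x(t,s) + Q(δ(t,s))·∂_s δ_y(t,s) ] ds. Then I is analytic in a neighbourhood of t_0, and if I is not identically zero near t_0, its order of vanishing at t_0 satisfies ord_{t_0} I ≤ A(n) + d·B(n). -/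
open scoped BigOperators

/-- The order of vanishing at `t₀` of a function analytic near `t₀`. -/
noncomputable def ordAt (f : ℂ → ℂ) (t₀ : ℂ) : ℕ := sInf {k | iteratedDeriv k f t₀ ≠ 0}

section LoopIntegrals

open Set Filter Topology Metric

/-- Differentiation under the integral sign over `[0, 1]` for a jointly continuous derivative. -/
theorem hasFDerivAt_integral_of_continuousOn_fderiv {E : Type*} [NormedAddCommGroup E]
    [NormedSpace ℂ E] [ProperSpace E] {F : E → ℝ → ℂ} {F' : E → ℝ → E →L[ℂ] ℂ} {u : Set E}
    (hu : IsOpen u) (hF : ∀ z ∈ u, ∀ s ∈ Icc (0 : ℝ) 1, HasFDerivAt (fun z => F z s) (F' z s) z)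
    (hFc : ∀ z ∈ u, ContinuousOn (F z) (Icc 0 1))
    (hF' : ContinuousOn (fun w : E × ℝ => F' w.1 w.2) (u ×ˢ Icc 0 1)) {z : E} (hz : z ∈ u) :
    HasFDerivAt (fun z => ∫ s in (0 : ℝ)..1, F z s) (∫ s in (0 : ℝ)..1, F' z s) z := by
  have huIoc : uIoc (0 : ℝ) 1 ⊆ Icc 0 1 := by
    rw [uIoc_of_le zero_le_one]; exact Ioc_subset_Icc_self
  have hF'z : ContinuousOn (F' z) (Icc 0 1) :=
    hF'.comp (f := fun s : ℝ => (z, s)) (by fun_prop) fun s hs => ⟨hz, hs⟩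
  obtain ⟨ε, hε, hεr⟩ := nhds_basis_closedBall.mem_iff.1 (hu.mem_nhds hz)
  have hK : IsCompact (closedBall z ε ×ˢ Icc (0 : ℝ) 1) :=
    (isCompact_closedBall z ε).prod isCompact_Icc
  obtain ⟨M, hM⟩ := hK.exists_bound_of_continuousOn (hF'.mono (prod_mono hεr subset_rfl))
  refine intervalIntegral.hasFDerivAt_integral_of_dominated_of_fderiv_le (F' := F')
    (bound := fun _ => M) (closedBall_mem_nhds z hε) ?_ ?_ ?_ ?_ (by simp) ?_
  · filter_upwards [hu.mem_nhds hz] with w hw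
    exact ((hFc w hw).mono huIoc).aestronglyMeasurable measurableSet_uIoc
  · refine ContinuousOn.intervalIntegrable ?_
    rw [uIcc_of_le zero_le_one]; exact hFc z hz
  · exact (hF'z.mono huIoc).aestronglyMeasurable measurableSet_uIoc
  · exact Eventually.of_forall fun s hs w hw => hM (w, s) ⟨hw, huIoc hs⟩
  · exact Eventually.of_forall fun s hs w hw => hF w (hεr hw) s (huIoc hs)

set_option maxHeartbeats 400000 in
/-- A function analytic on a bidisk has an analytic primitive in the second variable. -/
theorem exists_hasFDerivAt_partial_primitive {h : ℂ × ℂ → ℂ} {c : ℂ × ℂ} {r : ℝ}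
    (hh : AnalyticOnNhd ℂ h (ball c r)) :
    ∃ G : ℂ × ℂ → ℂ, ∀ z ∈ ball c r, ∃ L : ℂ × ℂ →L[ℂ] ℂ, HasFDerivAt G L z ∧ L (0, 1) = h z := by
  let A : ℝ → ℂ × ℂ →L[ℂ] ℂ × ℂ := fun s =>
    (ContinuousLinearMap.fst ℂ ℂ ℂ).prod ((s : ℂ) • ContinuousLinearMap.snd ℂ ℂ ℂ)
  let p : ℂ × ℂ → ℝ → ℂ × ℂ := fun z s => (z.1, c.2 + (s : ℂ) * (z.2 - c.2))
  have hpA : ∀ z s, HasFDerivAt (fun z => p z s) (A s) z := by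
    intro z s
    refine hasFDerivAt_fst.prodMk ?_
    exact ((hasFDerivAt_snd.sub_const c.2).const_mul (s : ℂ)).const_add c.2
  have hpc : Continuous (fun w : (ℂ × ℂ) × ℝ => p w.1 w.2) := by fun_prop
  have hAc : Continuous (fun w : (ℂ × ℂ) × ℝ => A w.2) := by
    refine continuous_clm_apply.2 fun v => ?_
    simp only [A, ContinuousLinearMap.prod_apply, _root_.smul_apply]
    fun_prop
  have hpm : ∀ z ∈ ball c r, ∀ s ∈ Icc (0 : ℝ) 1, p z s ∈ ball c r := by
    intro z hz s hs
    rw [mem_ball, Prod.dist_eq, max_lt_iff] at hz ⊢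
    refine ⟨hz.1, ?_⟩
    have : dist (p z s).2 c.2 = s * dist z.2 c.2 := by
      simp [p, dist_eq_norm, abs_of_nonneg hs.1]
    rw [this]
    nlinarith [hs.1, hs.2, dist_nonneg (x := z.2) (y := c.2)]
  let F : ℂ × ℂ → ℝ → ℂ := fun z s => (z.2 - c.2) * h (p z s)
  let F' : ℂ × ℂ → ℝ → ℂ × ℂ →L[ℂ] ℂ := fun z s =>
    (z.2 - c.2) • (fderiv ℂ h (p z s)).comp (A s) + h (p z s) • ContinuousLinearMap.snd ℂ ℂ ℂ
  have hF : ∀ z ∈ ball c r, ∀ s ∈ Icc (0 : ℝ) 1, HasFDerivAt (fun z => F z s) (F' z s) z := by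
    intro z hz s hs
    have h1 := ((hh _ (hpm z hz s hs)).differentiableAt.hasFDerivAt).comp z (hpA z s)
    exact (hasFDerivAt_snd.sub_const c.2).mul h1
  have hhp : ContinuousOn (fun w : (ℂ × ℂ) × ℝ => h (p w.1 w.2)) (ball c r ×ˢ Icc 0 1) :=
    hh.continuousOn.comp hpc.continuousOn fun w hw => hpm _ hw.1 _ hw.2
  have hdp : ContinuousOn (fun w : (ℂ × ℂ) × ℝ => fderiv ℂ h (p w.1 w.2))
      (ball c r ×ˢ Icc 0 1) :=
    hh.fderiv.continuousOn.comp hpc.continuousOn fun w hw => hpm _ hw.1 _ hw.2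
  have hF'c : ContinuousOn (fun w : (ℂ × ℂ) × ℝ => F' w.1 w.2) (ball c r ×ˢ Icc 0 1) := by
    have h1 : ContinuousOn (fun w : (ℂ × ℂ) × ℝ => w.1.2 - c.2) (ball c r ×ˢ Icc 0 1) := by
      fun_prop
    have h2 : ContinuousOn (fun w : (ℂ × ℂ) × ℝ => (fderiv ℂ h (p w.1 w.2)).comp (A w.2))
        (ball c r ×ˢ Icc 0 1) := hdp.clm_comp hAc.continuousOn
    have h3 : ContinuousOn (fun w : (ℂ × ℂ) × ℝ =>
        h (p w.1 w.2) • ContinuousLinearMap.snd ℂ ℂ ℂ) (ball c r ×ˢ Icc 0 1) :=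
      hhp.smul continuousOn_const
    exact (h1.smul h2).add h3
  have hFc : ∀ z ∈ ball c r, ContinuousOn (F z) (Icc 0 1) := by
    intro z hz
    have h1 : ContinuousOn (fun s : ℝ => h (p z s)) (Icc 0 1) :=
      hh.continuousOn.comp (by fun_prop) fun s hs => hpm z hz s hs
    exact continuousOn_const.mul h1
  refine ⟨fun z => ∫ s in (0:ℝ)..1, F z s, fun z hz => ⟨∫ s in (0:ℝ)..1, F' z s,
    hasFDerivAt_integral_of_continuousOn_fderiv isOpen_ball hF hFc hF'c hz, ?_⟩⟩
  · have hF'z : ContinuousOn (F' z) (Icc 0 1) :=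
      ContinuousOn.comp (g := fun w : (ℂ × ℂ) × ℝ => F' w.1 w.2) (f := fun s : ℝ => (z, s))
        hF'c (by fun_prop) fun s hs => ⟨hz, hs⟩
    have hint : IntervalIntegrable (F' z) MeasureTheory.volume 0 1 := by
      refine ContinuousOn.intervalIntegrable ?_
      rw [uIcc_of_le zero_le_one]; exact hF'z
    rw [ContinuousLinearMap.intervalIntegral_apply hint]
    have hd : ∀ s ∈ uIcc (0 : ℝ) 1,
        HasDerivAt (fun s : ℝ => (s : ℂ) * h (p z s)) (F' z s (0, 1)) s := by
      intro s hs
      rw [uIcc_of_le zero_le_one] at hs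
      have hs1 : HasDerivAt (fun s : ℝ => (s : ℂ)) 1 s := Complex.ofRealCLM.hasDerivAt
      have hp1 : HasDerivAt (fun s : ℝ => p z s) (0, z.2 - c.2) s := by
        refine (hasDerivAt_const s z.1).prodMk ?_
        simpa using (hs1.mul_const (z.2 - c.2)).const_add c.2
      have h1 := ((hh _ (hpm z hz s hs)).differentiableAt.hasFDerivAt.restrictScalars
        ℝ).comp_hasDerivAt s hp1
      refine (hs1.mul h1).congr_deriv ?_
      have e : (0, z.2 - c.2) = (z.2 - c.2) • ((0, 1) : ℂ × ℂ) := by simp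
      have e2 : A s (0, 1) = (s : ℂ) • ((0, 1) : ℂ × ℂ) := by simp [A]
      rw [e, ContinuousLinearMap.coe_restrictScalars', map_smul]
      simp only [F', add_apply, _root_.smul_apply,
        ContinuousLinearMap.comp_apply, e2, map_smul]
      simp
      ring
    rw [intervalIntegral.integral_eq_sub_of_hasDerivAt hd]
    · simp [p]
    · refine ContinuousOn.intervalIntegrable ?_
      rw [uIcc_of_le zero_le_one]
      exact hF'z.clm_apply continuousOn_const

/-- Near a regular point `H` is the first coordinate of an analytic chart. -/
theorem exists_analytic_chart {H : ℂ × ℂ → ℂ} (hH : AnalyticOnNhd ℂ H univ) {q : ℂ × ℂ}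
    (hq : fderiv ℂ H q ≠ 0) :
    ∃ (l : ℂ × ℂ →L[ℂ] ℂ) (Ψ : ℂ × ℂ → ℂ × ℂ) (r : ℝ), 0 < r ∧
      Ψ (H q, l q) = q ∧ AnalyticOnNhd ℂ Ψ (ball (H q, l q) r) ∧
      (∀ z ∈ ball (H q, l q) r, H (Ψ z) = z.1) ∧ ∀ᶠ p in 𝓝 q, Ψ (H p, l p) = p := by
  obtain ⟨l, hl⟩ : ∃ l : ℂ × ℂ →L[ℂ] ℂ, ∀ v, fderiv ℂ H q v = 0 → l v = 0 → v = 0 := by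
    have key : ∀ v : ℂ × ℂ, fderiv ℂ H q v
        = v.1 * fderiv ℂ H q (1, 0) + v.2 * fderiv ℂ H q (0, 1) := by
      intro v
      have : v = v.1 • ((1, 0) : ℂ × ℂ) + v.2 • ((0, 1) : ℂ × ℂ) := by ext <;> simp
      conv_lhs => rw [this]
      simp only [map_add, map_smul, smul_eq_mul]
    by_cases h : fderiv ℂ H q (0, 1) = 0
    · refine ⟨ContinuousLinearMap.snd ℂ ℂ ℂ, fun v h1 h2 => ?_⟩
      have h2' : v.2 = 0 := h2
      have h3 : fderiv ℂ H q (1, 0) ≠ 0 := by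
        intro h3
        apply hq
        ext <;> simp [h, h3]
      rw [key, h2'] at h1
      exact Prod.ext (by simpa [h3] using h1) h2'
    · refine ⟨ContinuousLinearMap.fst ℂ ℂ ℂ, fun v h1 h2 => ?_⟩
      have h2' : v.1 = 0 := h2
      rw [key, h2'] at h1
      exact Prod.ext h2' (by simpa [h] using h1)
  let Φ : ℂ × ℂ → ℂ × ℂ := fun p => (H p, l p)
  have hΦ : AnalyticAt ℂ Φ q := (hH q (mem_univ _)).prod (l.analyticAt q)
  let T : ℂ × ℂ →L[ℂ] ℂ × ℂ := (fderiv ℂ H q).prod l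
  have hT : Function.Injective T := by
    refine (injective_iff_map_eq_zero T).2 fun v hv => hl v ?_ ?_
    · exact congrArg Prod.fst hv
    · exact congrArg Prod.snd hv
  let e : (ℂ × ℂ) ≃L[ℂ] ℂ × ℂ :=
    (LinearEquiv.ofInjectiveEndo (T : ℂ × ℂ →ₗ[ℂ] ℂ × ℂ) hT).toContinuousLinearEquiv
  have he : (e : ℂ × ℂ →L[ℂ] ℂ × ℂ) = T := by ext <;> rfl
  have hd : HasFDerivAt Φ (e : ℂ × ℂ →L[ℂ] ℂ × ℂ) q := by
    rw [he]
    exact ((hH q (mem_univ _)).differentiableAt.hasFDerivAt).prodMk l.hasFDerivAt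
  have hc : ContDiffAt ℂ ⊤ Φ q := hΦ.contDiffAt
  have hs : HasStrictFDerivAt Φ (e : ℂ × ℂ →L[ℂ] ℂ × ℂ) q := hc.hasStrictFDerivAt' hd (by simp)
  have hinv : AnalyticAt ℂ (hs.localInverse Φ e q) (Φ q) :=
    (hc.to_localInverse hd (by simp)).analyticAt
  obtain ⟨r, hr, hball⟩ := nhds_basis_ball.eventually_iff.1
    (hinv.eventually_analyticAt.and hs.eventually_right_inverse)
  refine ⟨l, hs.localInverse Φ e q, r, hr, hs.localInverse_apply_image, fun z hz => (hball hz).1,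
    fun z hz => congrArg Prod.fst (hball hz).2, hs.eventually_left_inverse⟩

/-- Local primitives, relative to `H`, of the form `a dx` and of its Gelfand–Leray derivative
`b dx`. -/
theorem exists_local_primitives {H a b : ℂ × ℂ → ℂ} (hH : AnalyticOnNhd ℂ H univ)
    (ha : AnalyticOnNhd ℂ a univ) (hb : AnalyticOnNhd ℂ b univ)
    (hab : ∀ q, fderiv ℂ a q (0, 1) = fderiv ℂ H q (0, 1) * b q)
    {q : ℂ × ℂ} (hq : fderiv ℂ H q ≠ 0) :
    ∃ F G : ℂ × ℂ → ℂ, ∀ᶠ p in 𝓝 q,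
      HasFDerivAt F (a p • ContinuousLinearMap.fst ℂ ℂ ℂ + G p • fderiv ℂ H p) p ∧
      ∃ g : ℂ, HasFDerivAt G (b p • ContinuousLinearMap.fst ℂ ℂ ℂ + g • fderiv ℂ H p) p := by
  obtain ⟨l, Ψ, r, hr, -, hΨ, -, hleft⟩ := exists_analytic_chart hH hq
  have hHd : ∀ p, HasFDerivAt H (fderiv ℂ H p) p :=
    fun p => (hH p (mem_univ _)).differentiableAt.hasFDerivAt
  obtain ⟨Gc, hGc⟩ := exists_hasFDerivAt_partial_primitive
    (h := fun z => b (Ψ z) * (fderiv ℂ Ψ z (0, 1)).1) (c := (H q, l q)) (r := r) (by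
      intro z hz
      refine ((hb _ (mem_univ _)).comp (hΨ z hz)).mul ?_
      exact ((ContinuousLinearMap.fst ℂ ℂ ℂ).comp
        (ContinuousLinearMap.apply ℂ (ℂ × ℂ) ((0, 1) : ℂ × ℂ))).analyticAt _ |>.comp
          (hΨ.fderiv z hz))
  have hΦc : ContinuousAt (fun p => (H p, l p)) q :=
    (hH q (mem_univ _)).continuousAt.prodMk l.continuous.continuousAt
  have hG : ∀ᶠ p in 𝓝 q, ∃ g : ℂ, HasFDerivAt (fun p => Gc (H p, l p))
      (b p • ContinuousLinearMap.fst ℂ ℂ ℂ + g • fderiv ℂ H p) p := by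
    filter_upwards [hΦc.eventually (isOpen_ball.mem_nhds (mem_ball_self hr)),
      hleft.eventually_nhds] with p hp hleftp
    obtain ⟨L, hL, hL1⟩ := hGc _ hp
    have hΦp : HasFDerivAt (fun p => (H p, l p)) ((fderiv ℂ H p).prod l) p :=
      (hHd p).prodMk l.hasFDerivAt
    have hid : (fderiv ℂ Ψ (H p, l p)).comp ((fderiv ℂ H p).prod l)
        = ContinuousLinearMap.id ℂ (ℂ × ℂ) := by
      have h1 := ((hΨ _ hp).differentiableAt.hasFDerivAt).comp p hΦp
      have h2 : HasFDerivAt (fun p => Ψ (H p, l p)) (ContinuousLinearMap.id ℂ (ℂ × ℂ)) p :=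
        (hasFDerivAt_id p).congr_of_eventuallyEq hleftp
      exact h1.unique h2
    refine ⟨L (1, 0) - b p * (fderiv ℂ Ψ (H p, l p) (1, 0)).1,
      (hL.comp p hΦp).congr_fderiv ?_⟩
    refine ContinuousLinearMap.ext fun v => ?_
    have hv : ∀ s t : ℂ, ((s, t) : ℂ × ℂ) = s • ((1, 0) : ℂ × ℂ) + t • ((0, 1) : ℂ × ℂ) := by
      intro s t; ext <;> simp
    have hidv := congrArg Prod.fst (DFunLike.congr_fun hid v)
    rw [ContinuousLinearMap.comp_apply, ContinuousLinearMap.prod_apply, hv (fderiv ℂ H p v), map_add, map_smul,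
      map_smul] at hidv
    simp only [ContinuousLinearMap.comp_apply, ContinuousLinearMap.prod_apply]
    rw [hv (fderiv ℂ H p v), map_add, map_smul, map_smul, hL1, hleftp.self_of_nhds]
    simp only [Prod.fst_add, Prod.smul_fst, smul_eq_mul, ContinuousLinearMap.id_apply] at hidv
    simp only [smul_eq_mul, add_apply, _root_.smul_apply, ContinuousLinearMap.coe_fst', ← hidv]
    ring
  set G : ℂ × ℂ → ℂ := fun p => Gc (H p, l p)
  obtain ⟨ε, hε, hball⟩ := nhds_basis_ball.eventually_iff.1 hG
  let w : ℂ × ℂ → ℂ × ℂ →L[ℂ] ℂ :=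
    fun p => a p • ContinuousLinearMap.fst ℂ ℂ ℂ + G p • fderiv ℂ H p
  have hw : ∀ p ∈ ball q ε, ∃ D : ℂ × ℂ →L[ℂ] ℂ × ℂ →L[ℂ] ℂ, HasFDerivAt w D p ∧
      ∀ x y, D x y = D y x := by
    intro p hp
    obtain ⟨g, hg⟩ := hball hp
    have hA := (ha p (mem_univ _)).differentiableAt.hasFDerivAt
    have hH2 := (hH.fderiv p (mem_univ _)).differentiableAt.hasFDerivAt
    have hsymm : ∀ x y, fderiv ℂ (fderiv ℂ H) p x y = fderiv ℂ (fderiv ℂ H) p y x :=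
      fun x y => second_derivative_symmetric (f := H) (f' := fderiv ℂ H) hHd hH2 x y
    refine ⟨_, (hA.smul_const _).add (hg.smul hH2), fun x y => ?_⟩
    have hv : ∀ (M : ℂ × ℂ →L[ℂ] ℂ) (v : ℂ × ℂ), M v = v.1 * M (1, 0) + v.2 * M (0, 1) := by
      intro M v
      have : v = v.1 • ((1, 0) : ℂ × ℂ) + v.2 • ((0, 1) : ℂ × ℂ) := by ext <;> simp
      conv_lhs => rw [this]
      simp only [map_add, map_smul, smul_eq_mul]
    simp only [add_apply, _root_.smul_apply, ContinuousLinearMap.smulRight_apply, hsymm x y,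
      smul_eq_mul, ContinuousLinearMap.coe_fst']
    rw [hv (fderiv ℂ a p) x, hv (fderiv ℂ a p) y, hv (fderiv ℂ H p) x, hv (fderiv ℂ H p) y, hab p]
    ring
  obtain ⟨F, hF⟩ := (convex_ball q ε).exists_forall_hasFDerivAt_of_fderiv_symmetric (𝕜 := ℂ)
    (ω := w) isOpen_ball
    (fun p hp => by
      obtain ⟨D, hD, -⟩ := hw p hp
      exact (hD.restrictScalars ℝ).differentiableAt.differentiableWithinAt)
    (fun p hp x y => by
      obtain ⟨D, hD, hs⟩ := hw p hp
      rw [(hD.restrictScalars ℝ).fderiv]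
      exact hs x y)
  exact ⟨F, G, nhds_basis_ball.eventually_iff.2 ⟨ε, hε, fun p hp => ⟨hF p hp, hball hp⟩⟩⟩

/-- A function whose differential is `g dH` depends only on `H`, with derivative `g`. -/
theorem hasDerivAt_comp_of_fderiv_eq_smul {H f g : ℂ × ℂ → ℂ} (hH : AnalyticOnNhd ℂ H univ)
    {q : ℂ × ℂ} (hq : fderiv ℂ H q ≠ 0)
    (hf : ∀ᶠ p in 𝓝 q, HasFDerivAt f (g p • fderiv ℂ H p) p)
    {c : ℂ → ℂ × ℂ} {t₀ : ℂ} (hc : ContinuousAt c t₀) (hcq : c t₀ = q)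
    (hHc : ∀ᶠ t in 𝓝 t₀, H (c t) = t) :
    HasDerivAt (fun t => f (c t)) (g q) t₀ := by
  obtain ⟨l, Ψ, r, hr, hΨq, hΨ, hHΨ, hleft⟩ := exists_analytic_chart hH hq
  have hHq : H q = t₀ := hcq ▸ hHc.self_of_nhds
  rw [hHq] at hΨ hHΨ hΨq
  have hΨc : ContinuousAt Ψ (t₀, l q) := (hΨ _ (mem_ball_self hr)).continuousAt
  obtain ⟨ε, hε, hball⟩ := nhds_basis_ball.eventually_iff.1
    ((isOpen_ball.eventually_mem (mem_ball_self hr)).and (hΨc.eventually (hΨq.symm ▸ hf)))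
  have hk : ∀ z ∈ ball ((t₀, l q) : ℂ × ℂ) ε,
      HasFDerivAt (fun z => f (Ψ z)) (g (Ψ z) • ContinuousLinearMap.fst ℂ ℂ ℂ) z := by
    intro z hz
    obtain ⟨hz1, hz2⟩ := hball hz
    have h1 := (hΨ z hz1).differentiableAt.hasFDerivAt
    have h2 := ((hH (Ψ z) (mem_univ _)).differentiableAt.hasFDerivAt).comp z h1
    have h3 : HasFDerivAt (H ∘ Ψ) (ContinuousLinearMap.fst ℂ ℂ ℂ) z := by
      refine hasFDerivAt_fst.congr_of_eventuallyEq ?_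
      filter_upwards [isOpen_ball.mem_nhds hz1] with w hw using hHΨ w hw
    rw [← h2.unique h3]
    exact hz2.comp z h1
  have hconst : ∀ t ∈ ball t₀ ε, ∀ u ∈ ball (l q) ε, f (Ψ (t, u)) = f (Ψ (t, l q)) := by
    intro t ht u hu
    have hmem : ∀ u ∈ ball (l q) ε, ((t, u) : ℂ × ℂ) ∈ ball (t₀, l q) ε := by
      intro u hu
      rw [← ball_prod_same]
      exact ⟨ht, hu⟩
    have hd : ∀ u ∈ ball (l q) ε, HasDerivAt (fun u => f (Ψ (t, u))) 0 u := by
      intro u hu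
      have := (hk _ (hmem u hu)).comp_hasDerivAt u ((hasDerivAt_const u t).prodMk (hasDerivAt_id u))
      exact this.congr_deriv (by simp)
    exact isOpen_ball.is_const_of_deriv_eq_zero (convex_ball _ _).isPreconnected
      (fun u hu => (hd u hu).differentiableAt.differentiableWithinAt)
      (fun u hu => (hd u hu).deriv) hu (mem_ball_self hε)
  have hd : HasDerivAt (fun t => f (Ψ (t, l q))) (g q) t₀ := by
    have := (hk _ (mem_ball_self hε)).comp_hasDerivAt t₀
      ((hasDerivAt_id t₀).prodMk (hasDerivAt_const t₀ (l q)))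
    exact this.congr_deriv (by simp [hΨq])
  refine hd.congr_of_eventuallyEq ?_
  have hc' : Tendsto c (𝓝 t₀) (𝓝 q) := hcq ▸ hc
  filter_upwards [hHc, hc'.eventually hleft, isOpen_ball.mem_nhds (mem_ball_self (x := t₀) hε),
    (l.continuous.tendsto q).comp hc' (isOpen_ball.mem_nhds (mem_ball_self hε))]
    with t h1 h2 h3 h4
  rw [h1] at h2
  rw [← hconst t h3 _ h4, Function.comp_apply, h2]

/-- The derivative of `∮ a dx` along a continuous family of loops in the fibres of `H` is the
integral of the Gelfand–Leray derivative `b dx`. -/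
theorem hasDerivAt_integral_loop {H a b : ℂ × ℂ → ℂ} (hH : AnalyticOnNhd ℂ H univ)
    (ha : AnalyticOnNhd ℂ a univ) (hb : AnalyticOnNhd ℂ b univ)
    (hab : ∀ q, fderiv ℂ a q (0, 1) = fderiv ℂ H q (0, 1) * b q)
    {U : Set ℂ} (hU : IsOpen U) {γ γ' : ℂ → ℝ → ℂ × ℂ}
    (hc : ContinuousOn (fun q : ℂ × ℝ => γ q.1 q.2) (U ×ˢ univ))
    (hper : ∀ t ∈ U, γ t 1 = γ t 0)
    (hd : ∀ t ∈ U, ∀ s, HasDerivAt (γ t) (γ' t s) s)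
    (hc' : ContinuousOn (fun q : ℂ × ℝ => γ' q.1 q.2) (U ×ˢ univ))
    (hHγ : ∀ t ∈ U, ∀ s, H (γ t s) = t) {t₀ : ℂ} (ht₀ : t₀ ∈ U)
    (hreg : ∀ s, fderiv ℂ H (γ t₀ s) ≠ 0) :
    HasDerivAt (fun t => ∫ s in (0 : ℝ)..1, a (γ t s) * (γ' t s).1)
      (∫ s in (0 : ℝ)..1, b (γ t₀ s) * (γ' t₀ s).1) t₀ := by
  have hex : ∀ q, ∃ F G : ℂ × ℂ → ℂ, fderiv ℂ H q ≠ 0 → ∀ᶠ p in 𝓝 q,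
      HasFDerivAt F (a p • ContinuousLinearMap.fst ℂ ℂ ℂ + G p • fderiv ℂ H p) p ∧
      ∃ g : ℂ, HasFDerivAt G (b p • ContinuousLinearMap.fst ℂ ℂ ℂ + g • fderiv ℂ H p) p := by
    intro q
    by_cases hq : fderiv ℂ H q = 0
    · exact ⟨0, 0, fun h => absurd hq h⟩
    · obtain ⟨F, G, h⟩ := exists_local_primitives hH ha hb hab hq
      exact ⟨F, G, fun _ => h⟩
  choose F G hFG using hex
  have hUt : ∀ᶠ t in 𝓝 t₀, t ∈ U := hU.mem_nhds ht₀
  have hcs : ∀ t ∈ U, Continuous (γ t) := fun t ht =>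
    continuous_iff_continuousAt.2 fun s => (hd t ht s).continuousAt
  have hcs' : ∀ t ∈ U, Continuous (γ' t) := fun t ht =>
    continuousOn_univ.1 (hc'.comp (f := fun s : ℝ => (t, s)) (by fun_prop)
      fun s _ => ⟨ht, mem_univ _⟩)
  have hint : ∀ k : ℂ × ℂ → ℂ, AnalyticOnNhd ℂ k univ → ∀ t ∈ U, ∀ x y : ℝ,
      IntervalIntegrable (fun s => k (γ t s) * (γ' t s).1) MeasureTheory.volume x y := by
    intro k hk t ht x y
    have h1 : Continuous fun s => k (γ t s) :=
      (continuousOn_univ.1 hk.continuousOn).comp (hcs t ht)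
    exact (h1.mul (continuous_fst.comp (hcs' t ht))).intervalIntegrable x y
  have hker : ∀ t ∈ U, ∀ s, fderiv ℂ H (γ t s) (γ' t s) = 0 := by
    intro t ht s
    have h1 := ((hH (γ t s) (mem_univ _)).differentiableAt.hasFDerivAt.restrictScalars
      ℝ).comp_hasDerivAt s (hd t ht s)
    have h2 : HasDerivAt (H ∘ γ t) 0 s :=
      (hasDerivAt_const s t).congr_of_eventuallyEq (Eventually.of_forall fun s => hHγ t ht s)
    exact h1.unique h2
  have hcat : ∀ x, ContinuousAt (fun t => γ t x) t₀ := by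
    intro x
    have h1 : ContinuousAt (fun q : ℂ × ℝ => γ q.1 q.2) (t₀, x) :=
      hc.continuousAt ((hU.prod isOpen_univ).mem_nhds ⟨ht₀, mem_univ _⟩)
    exact ContinuousAt.comp (f := fun t : ℂ => (t, x)) h1 (by fun_prop)
  let P : ℝ → ℝ → Prop := fun x y => HasDerivAt
    (fun t => (∫ s in x..y, a (γ t s) * (γ' t s).1) - F (γ t₀ y) (γ t y) + F (γ t₀ x) (γ t x))
    ((∫ s in x..y, b (γ t₀ s) * (γ' t₀ s).1) - G (γ t₀ y) (γ t₀ y) + G (γ t₀ x) (γ t₀ x)) t₀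
  have hsymm : ∀ x y, P x y → P y x := by
    intro x y h
    refine ((HasDerivAt.neg h).congr_of_eventuallyEq (Eventually.of_forall fun t => ?_)).congr_deriv
      ?_
    · simp only [intervalIntegral.integral_symm x y, Pi.neg_apply]; ring
    · rw [intervalIntegral.integral_symm x y]; ring
  have htrans : ∀ x y z, P x y → P y z → P x z := by
    intro x y z h1 h2
    refine ((HasDerivAt.add h1 h2).congr_of_eventuallyEq ?_).congr_deriv ?_
    · filter_upwards [hUt] with t ht
      simp only [Pi.add_apply]
      rw [← intervalIntegral.integral_add_adjacent_intervals (hint a ha t ht x y)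
        (hint a ha t ht y z)]
      ring
    · rw [← intervalIntegral.integral_add_adjacent_intervals (hint b hb t₀ ht₀ x y)
        (hint b hb t₀ ht₀ y z)]
      ring
  have hloc : ∀ x, ∀ᶠ y in 𝓝 x, P x y := by
    intro x
    have h1 : ContinuousAt (fun q : ℂ × ℝ => γ q.1 q.2) (t₀, x) :=
      hc.continuousAt ((hU.prod isOpen_univ).mem_nhds ⟨ht₀, mem_univ _⟩)
    have h2 := h1.eventually (hFG (γ t₀ x) (hreg x)).eventually_nhds
    rw [nhds_prod_eq, (nhds_basis_ball.prod nhds_basis_ball).eventually_iff] at h2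
    obtain ⟨⟨ε₁, ε₂⟩, ⟨hε₁, hε₂⟩, h2⟩ := h2
    filter_upwards [isOpen_ball.mem_nhds (mem_ball_self (x := x) hε₂)] with y hy
    have hsub : ∀ s ∈ uIcc x y, s ∈ ball x ε₂ := fun s hs =>
      (convex_ball x ε₂).ordConnected.uIcc_subset (mem_ball_self hε₂) hy hs
    have hinta : ∀ t ∈ ball t₀ ε₁, t ∈ U → ∫ s in x..y, a (γ t s) * (γ' t s).1
        = F (γ t₀ x) (γ t y) - F (γ t₀ x) (γ t x) := by
      intro t ht htU
      refine intervalIntegral.integral_eq_sub_of_hasDerivAt (f := fun s => F (γ t₀ x) (γ t s))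
        (fun s hs => ?_) (hint a ha t htU x y)
      have h3 := (h2 (show (t, s) ∈ _ from ⟨ht, hsub s hs⟩)).self_of_nhds.1
      refine ((h3.restrictScalars ℝ).comp_hasDerivAt s (hd t htU s)).congr_deriv ?_
      simp [hker t htU s]
    have hintb : ∫ s in x..y, b (γ t₀ s) * (γ' t₀ s).1
        = G (γ t₀ x) (γ t₀ y) - G (γ t₀ x) (γ t₀ x) := by
      refine intervalIntegral.integral_eq_sub_of_hasDerivAt (f := fun s => G (γ t₀ x) (γ t₀ s))
        (fun s hs => ?_) (hint b hb t₀ ht₀ x y)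
      obtain ⟨g, hg⟩ :=
        (h2 (show (t₀, s) ∈ _ from ⟨mem_ball_self hε₁, hsub s hs⟩)).self_of_nhds.2
      refine ((hg.restrictScalars ℝ).comp_hasDerivAt s (hd t₀ ht₀ s)).congr_deriv ?_
      simp [hker t₀ ht₀ s]
    have h4 : HasDerivAt (fun t => (F (γ t₀ x) - F (γ t₀ y)) (γ t y))
        ((G (γ t₀ x) - G (γ t₀ y)) (γ t₀ y)) t₀ := by
      refine hasDerivAt_comp_of_fderiv_eq_smul hH (hreg y) ?_ (hcat y) rfl
        (hUt.mono fun t ht => hHγ t ht y)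
      filter_upwards [h2 (show (t₀, y) ∈ _ from ⟨mem_ball_self hε₁, hy⟩),
        hFG (γ t₀ y) (hreg y)] with p hp1 hp2
      refine (hp1.1.sub hp2.1).congr_fderiv ?_
      refine ContinuousLinearMap.ext fun v => ?_
      simp
      ring
    refine (h4.congr_of_eventuallyEq ?_).congr_deriv ?_
    · filter_upwards [hUt, isOpen_ball.mem_nhds (mem_ball_self (x := t₀) hε₁)] with t ht1 ht2
      rw [hinta t ht2 ht1, Pi.sub_apply]; ring
    · rw [hintb, Pi.sub_apply]; ring
  have hP : P 0 1 := by
    have : Std.Symm P := ⟨hsymm⟩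
    exact PreconnectedSpace.induction₂ P hloc ⟨htrans⟩ 0 1
  refine (HasDerivAt.congr_of_eventuallyEq hP ?_).congr_deriv ?_
  · filter_upwards [hUt] with t ht
    rw [hper t ht, hper t₀ ht₀]; ring
  · rw [hper t₀ ht₀]; ring

/-- A matrix with linearly independent rows over a domain has a nonzero maximal minor. -/
theorem exists_submatrix_det_ne_zero {R : Type*} [CommRing R] [IsDomain R] {m n : ℕ}
    {M : Matrix (Fin m) (Fin n) R} (hM : LinearIndependent R fun i => M i) :
    ∃ s : Fin m → Fin n, (M.submatrix id s).det ≠ 0 := by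
  let K := FractionRing R
  let N : Matrix (Fin m) (Fin n) K := M.map (algebraMap R K)
  have hN : LinearIndependent K N.row := by
    rw [← LinearIndependent.iff_fractionRing R K]
    refine hM.map_injOn ((Algebra.linearMap R K).compLeft (Fin n)) ?_
    intro v _ w _ h
    funext j
    exact IsFractionRing.injective R K (congrFun h j)
  have hrank := hN.rank_matrix
  rw [Matrix.rank_eq_finrank_span_cols, Fintype.card_fin] at hrank
  obtain ⟨f, hf, -, hli⟩ := Submodule.exists_fun_fin_finrank_span_eq K (Set.range N.col)
  choose s hs using hf
  refine ⟨fun i => s (Fin.cast hrank.symm i), fun h => ?_⟩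
  have h1 : LinearIndependent K (N.submatrix id fun i => s (Fin.cast hrank.symm i)).col := by
    have : (N.submatrix id fun i => s (Fin.cast hrank.symm i)).col
        = f ∘ Fin.cast hrank.symm := by
      funext i
      exact hs (Fin.cast hrank.symm i)
    rw [this]
    exact hli.comp _ (Fin.cast_injective _)
  rw [Matrix.linearIndependent_cols_iff_isUnit, Matrix.isUnit_iff_isUnit_det] at h1
  refine h1.ne_zero ?_
  have : N.submatrix id (fun i => s (Fin.cast hrank.symm i))
      = (algebraMap R K).mapMatrix (M.submatrix id fun i => s (Fin.cast hrank.symm i)) := rfl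
  rw [this, ← RingHom.map_det, h, map_zero]

/-- Cramer's rule for the span of linearly independent vectors, with a degree bound. -/
theorem exists_smul_mem_span_of_linearIndependent {k : Type*} [Field k] {m n e : ℕ}
    {q : Fin m → Fin n → Polynomial k} (hq : LinearIndependent (Polynomial k) q)
    (hdeg : ∀ i j, (q i j).natDegree ≤ e) :
    ∃ Δ : Polynomial k, Δ ≠ 0 ∧ Δ.natDegree ≤ m * e ∧ ∀ (a : Polynomial k), a ≠ 0 →
      ∀ v, a • v ∈ Submodule.span (Polynomial k) (range q) →
        Δ • v ∈ Submodule.span (Polynomial k) (range q) := by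
  obtain ⟨s, hs⟩ := exists_submatrix_det_ne_zero (M := q) hq
  refine ⟨_, hs, ?_, ?_⟩
  · rw [Matrix.det_apply]
    refine Polynomial.natDegree_sum_le_of_forall_le _ _ fun σ _ => ?_
    refine (Polynomial.natDegree_smul_le _ _).trans ((Polynomial.natDegree_prod_le _ _).trans ?_)
    exact (Finset.sum_le_card_nsmul _ _ e fun i _ => hdeg _ _).trans (by simp)
  · intro a ha v hv
    obtain ⟨c, hc⟩ := (Submodule.mem_span_range_iff_exists_fun _).1 hv
    let M := Matrix.submatrix (Matrix.of q) id s
    let w := Matrix.vecMul (fun j => v (s j)) M.adjugate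
    have h1 : Matrix.vecMul c M = a • fun j => v (s j) := by
      funext j
      have := congrFun hc (s j)
      simpa [M, Matrix.vecMul, dotProduct] using this
    have h2 : a • w = M.det • c := by
      rw [← Matrix.smul_vecMul, ← h1, Matrix.vecMul_vecMul, Matrix.mul_adjugate,
        Matrix.vecMul_smul, Matrix.vecMul_one]
    have h3 : a • (M.det • v) = a • ∑ i, w i • q i := by
      rw [smul_comm, ← hc, Finset.smul_sum, Finset.smul_sum]
      refine Finset.sum_congr rfl fun i _ => ?_
      rw [smul_smul, smul_smul]
      exact congrArg (· • q i) (congrFun h2 i).symm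
    have h4 := smul_right_injective _ ha h3
    exact h4 ▸ Submodule.sum_mem _ fun i _ =>
      Submodule.smul_mem _ _ (Submodule.subset_span (mem_range_self i))

/-- The covariant derivative of a vector of polynomials for the linear system `D K' = C K`. -/
noncomputable def polyConnection {n : ℕ} (D : Polynomial ℂ) (C : Fin n → Fin n → Polynomial ℂ)
    (q : Fin n → Polynomial ℂ) : Fin n → Polynomial ℂ :=
  fun j => D * Polynomial.derivative (q j) + ∑ i, q i * C i j

/-- The combination of the functions `K i` with polynomial coefficients `q i`. -/
noncomputable def polyPairing {n : ℕ} (K : Fin n → ℂ → ℂ) (q : Fin n → Polynomial ℂ) (t : ℂ) : ℂ :=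
  ∑ i, (q i).eval t * K i t

theorem polyConnection_add {n : ℕ} (D : Polynomial ℂ) (C : Fin n → Fin n → Polynomial ℂ)
    (v w : Fin n → Polynomial ℂ) :
    polyConnection D C (v + w) = polyConnection D C v + polyConnection D C w := by
  funext j
  simp only [polyConnection, Pi.add_apply, map_add, add_mul, Finset.sum_add_distrib]
  ring

theorem polyConnection_smul {n : ℕ} (D : Polynomial ℂ) (C : Fin n → Fin n → Polynomial ℂ)
    (r : Polynomial ℂ) (v : Fin n → Polynomial ℂ) :
    polyConnection D C (r • v)
      = r • polyConnection D C v + (D * Polynomial.derivative r) • v := by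
  funext j
  simp only [polyConnection, Pi.add_apply, Pi.smul_apply, smul_eq_mul, Polynomial.derivative_mul,
    mul_add, Finset.mul_sum]
  simp only [mul_assoc]
  ring

theorem natDegree_polyConnection_le {n e c : ℕ} {D : Polynomial ℂ}
    {C : Fin n → Fin n → Polynomial ℂ} (hD : D.natDegree ≤ c) (hC : ∀ i j, (C i j).natDegree ≤ c)
    {q : Fin n → Polynomial ℂ} (hq : ∀ i, (q i).natDegree ≤ e) (j : Fin n) :
    (polyConnection D C q j).natDegree ≤ e + c := by
  refine Polynomial.natDegree_add_le_of_degree_le ?_ ?_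
  · refine Polynomial.natDegree_mul_le.trans ?_
    have := Polynomial.natDegree_derivative_le (q j)
    have := hq j
    omega
  · refine Polynomial.natDegree_sum_le_of_forall_le _ _ fun i _ => ?_
    exact Polynomial.natDegree_mul_le.trans (add_le_add (hq i) (hC i j))

theorem natDegree_polyConnection_iterate_le {n e c : ℕ} {D : Polynomial ℂ}
    {C : Fin n → Fin n → Polynomial ℂ} (hD : D.natDegree ≤ c) (hC : ∀ i j, (C i j).natDegree ≤ c)
    {q : Fin n → Polynomial ℂ} (hq : ∀ i, (q i).natDegree ≤ e) (k : ℕ) (j : Fin n) :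
    ((polyConnection D C)^[k] q j).natDegree ≤ e + k * c := by
  induction k generalizing j with
  | zero => simpa using hq j
  | succ k ih =>
    rw [Function.iterate_succ_apply']
    refine (natDegree_polyConnection_le hD hC ih j).trans (le_of_eq ?_)
    ring

theorem analyticAt_eval (p : Polynomial ℂ) (t : ℂ) : AnalyticAt ℂ (fun t => p.eval t) t :=
  p.differentiable.analyticAt t

theorem analyticAt_polyPairing {n : ℕ} {K : Fin n → ℂ → ℂ} {t₀ : ℂ}
    (hK : ∀ i, AnalyticAt ℂ (K i) t₀) (q : Fin n → Polynomial ℂ) :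
    AnalyticAt ℂ (polyPairing K q) t₀ := by
  unfold polyPairing
  exact Finset.analyticAt_fun_sum _ fun i _ => (analyticAt_eval _ _).mul (hK i)

theorem polyPairing_polyConnection {n : ℕ} {K : Fin n → ℂ → ℂ} {t₀ : ℂ} {D : Polynomial ℂ}
    {C : Fin n → Fin n → Polynomial ℂ} (hK : ∀ i, AnalyticAt ℂ (K i) t₀)
    (hsys : ∀ᶠ t in 𝓝 t₀, ∀ i, D.eval t * deriv (K i) t = ∑ j, (C i j).eval t * K j t)
    (q : Fin n → Polynomial ℂ) :
    polyPairing K (polyConnection D C q)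
      =ᶠ[𝓝 t₀] fun t => D.eval t * deriv (polyPairing K q) t := by
  have hK' : ∀ᶠ t in 𝓝 t₀, ∀ i, AnalyticAt ℂ (K i) t :=
    eventually_all.2 fun i => (hK i).eventually_analyticAt
  filter_upwards [hsys, hK'] with t h1 h2
  have h3 : HasDerivAt (polyPairing K q)
      (∑ i, ((Polynomial.derivative (q i)).eval t * K i t + (q i).eval t * deriv (K i) t)) t := by
    unfold polyPairing
    exact HasDerivAt.fun_sum fun i _ =>
      ((q i).hasDerivAt t).mul (h2 i).differentiableAt.hasDerivAt
  rw [h3.deriv]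
  have h4 : ∀ i, D.eval t * ((q i).eval t * deriv (K i) t)
      = ∑ j, (q i).eval t * ((C i j).eval t * K j t) := by
    intro i
    rw [mul_left_comm, h1 i, Finset.mul_sum]
  simp only [polyPairing, polyConnection, Polynomial.eval_add, Polynomial.eval_mul,
    Polynomial.eval_finsetSum, add_mul, Finset.sum_add_distrib, mul_add, Finset.mul_sum, h4,
    Finset.sum_mul]
  rw [Finset.sum_comm (s := Finset.univ) (t := Finset.univ)]
  simp only [mul_assoc]

theorem natCast_le_analyticOrderAt_sum {ι : Type*} (s : Finset ι) {f : ι → ℂ → ℂ} {t₀ : ℂ} {N : ℕ∞}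
    (h : ∀ i ∈ s, N ≤ analyticOrderAt (f i) t₀) :
    N ≤ analyticOrderAt (fun t => ∑ i ∈ s, f i t) t₀ := by
  classical
  induction s using Finset.induction_on with
  | empty =>
    have : analyticOrderAt (fun t => ∑ i ∈ (∅ : Finset ι), f i t) t₀ = ⊤ :=
      analyticOrderAt_eq_top.2 (by simp)
    exact this.symm ▸ le_top
  | insert a s ha ih =>
    simp only [Finset.sum_insert ha]
    exact (le_min (h a (Finset.mem_insert_self a s))
      (ih fun i hi => h i (Finset.mem_insert_of_mem hi))).trans le_analyticOrderAt_add

theorem le_analyticOrderAt_eval_mul {f : ℂ → ℂ} {t₀ : ℂ} (hf : AnalyticAt ℂ f t₀)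
    (p : Polynomial ℂ) :
    analyticOrderAt f t₀ ≤ analyticOrderAt (fun t => p.eval t * f t) t₀ := by
  have := analyticOrderAt_mul (analyticAt_eval p t₀) hf
  exact this ▸ le_add_self

theorem analyticOrderAt_eval_mul_of_ne_zero {f : ℂ → ℂ} {t₀ : ℂ} (hf : AnalyticAt ℂ f t₀)
    {p : Polynomial ℂ} (hp : p.eval t₀ ≠ 0) :
    analyticOrderAt (fun t => p.eval t * f t) t₀ = analyticOrderAt f t₀ := by
  have h1 := analyticOrderAt_mul (analyticAt_eval p t₀) hf
  have h2 : analyticOrderAt (fun t => p.eval t) t₀ = 0 := analyticOrderAt_eq_zero.2 (Or.inr hp)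
  rw [h2, zero_add] at h1
  exact h1

theorem analyticOrderAt_eval_le_natDegree {p : Polynomial ℂ} (hp : p ≠ 0) (t₀ : ℂ) :
    analyticOrderAt (fun t => p.eval t) t₀ ≤ p.natDegree := by
  obtain ⟨g, hg, hndvd⟩ := p.exists_eq_pow_rootMultiplicity_mul_and_not_dvd hp t₀
  have h1 : analyticOrderAt (fun t => p.eval t) t₀ = (p.rootMultiplicity t₀ : ℕ) := by
    rw [(analyticAt_eval p t₀).analyticOrderAt_eq_natCast]
    refine ⟨fun t => g.eval t, analyticAt_eval g t₀, fun h => hndvd (Polynomial.dvd_iff_isRoot.2 h),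
      Eventually.of_forall fun t => ?_⟩
    conv_lhs => rw [hg]
    simp
  rw [h1]
  have := Polynomial.natDegree_le_of_dvd (p.pow_rootMultiplicity_dvd t₀) hp
  rw [Polynomial.natDegree_pow, Polynomial.natDegree_X_sub_C, mul_one] at this
  exact_mod_cast this

theorem natCast_le_analyticOrderAt_deriv {f : ℂ → ℂ} {t₀ : ℂ} {N : ℕ} (hf : AnalyticAt ℂ f t₀)
    (h : ((N + 1 : ℕ) : ℕ∞) ≤ analyticOrderAt f t₀) : (N : ℕ∞) ≤ analyticOrderAt (deriv f) t₀ := by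
  rw [natCast_le_analyticOrderAt_iff_iteratedDeriv_eq_zero hf] at h
  rw [natCast_le_analyticOrderAt_iff_iteratedDeriv_eq_zero hf.deriv]
  intro i hi
  rw [← iteratedDeriv_succ']
  exact h _ (by omega)

/-- Uniqueness for linear systems with nonsingular leading coefficient. -/
theorem eventually_eq_zero_of_linear_system {ι : Type*} (s : Finset ι) {u : ι → ℂ → ℂ} {t₀ : ℂ}
    {D : Polynomial ℂ} (hD : D.eval t₀ ≠ 0) {T : ι → ι → Polynomial ℂ}
    (hu : ∀ i ∈ s, AnalyticAt ℂ (u i) t₀) (hu0 : ∀ i ∈ s, u i t₀ = 0)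
    (hsys : ∀ i ∈ s, ∀ᶠ t in 𝓝 t₀, D.eval t * deriv (u i) t = ∑ j ∈ s, (T i j).eval t * u j t) :
    ∀ i ∈ s, ∀ᶠ t in 𝓝 t₀, u i t = 0 := by
  have key : ∀ N : ℕ, ∀ i ∈ s, (N : ℕ∞) ≤ analyticOrderAt (u i) t₀ := by
    intro N
    induction N with
    | zero => simp
    | succ N ih =>
      intro i hi
      have h1 : (N : ℕ∞) ≤ analyticOrderAt (deriv (u i)) t₀ := by
        rw [← analyticOrderAt_eval_mul_of_ne_zero (hu i hi).deriv hD,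
          analyticOrderAt_congr (hsys i hi)]
        exact natCast_le_analyticOrderAt_sum s fun j hj =>
          (ih j hj).trans (le_analyticOrderAt_eval_mul (hu j hj) _)
      rw [analyticOrderAt_deriv_ge_iff (hu i hi) (hu0 i hi)] at h1
      exact_mod_cast h1
  intro i hi
  exact analyticOrderAt_eq_top.1 (ENat.eq_top_iff_forall_ge.2 fun N => key N i hi)

/-- A combination with polynomial coefficients of solutions of a polynomial linear system, whose
order at a regular point exceeds an explicit bound affine in the degree, vanishes identically. -/
theorem polyPairing_eventually_eq_zero {n e c : ℕ} {K : Fin n → ℂ → ℂ} {t₀ : ℂ} {D : Polynomial ℂ}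
    {C : Fin n → Fin n → Polynomial ℂ} (hD : D.eval t₀ ≠ 0) (hDc : D.natDegree ≤ c)
    (hC : ∀ i j, (C i j).natDegree ≤ c) (hK : ∀ i, AnalyticAt ℂ (K i) t₀)
    (hsys : ∀ᶠ t in 𝓝 t₀, ∀ i, D.eval t * deriv (K i) t = ∑ j, (C i j).eval t * K j t)
    {q : Fin n → Polynomial ℂ} (hq : ∀ i, (q i).natDegree ≤ e)
    (hord : ((n + n * (e + n * c) : ℕ) : ℕ∞) ≤ analyticOrderAt (polyPairing K q) t₀) :
    ∀ᶠ t in 𝓝 t₀, polyPairing K q t = 0 := by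
  classical
  let w : ℕ → Fin n → Polynomial ℂ := fun k => (polyConnection D C)^[k] q
  have hw : ∀ k, polyConnection D C (w k) = w (k + 1) := fun k =>
    (Function.iterate_succ_apply' _ _ _).symm
  have hdep : ∃ m, ¬ LinearIndependent (Polynomial ℂ) fun i : Fin (m + 1) => w i := by
    refine ⟨n, fun h => ?_⟩
    have := h.fintype_card_le_finrank
    simp at this
  obtain ⟨m, hm, hmin⟩ : ∃ m, (¬ LinearIndependent (Polynomial ℂ) fun i : Fin (m + 1) => w i) ∧
      LinearIndependent (Polynomial ℂ) fun i : Fin m => w i := by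
    refine ⟨Nat.find hdep, Nat.find_spec hdep, ?_⟩
    rcases h : Nat.find hdep with _ | m
    · exact linearIndependent_empty_type
    · exact not_not.1 (Nat.find_min hdep (m := m) (by omega))
  have hmn : m ≤ n := by simpa using hmin.fintype_card_le_finrank
  let W : Submodule (Polynomial ℂ) (Fin n → Polynomial ℂ) :=
    Submodule.span _ (range fun i : Fin m => w i)
  obtain ⟨b, hb0, hb⟩ : ∃ b : Polynomial ℂ, b ≠ 0 ∧ b • w m ∈ W := by
    obtain ⟨g, hg, i, hi⟩ := Fintype.not_linearIndependent_iff.1 hm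
    rw [Fin.sum_univ_castSucc] at hg
    refine ⟨g (Fin.last m), fun h => hi ?_, ?_⟩
    · rw [h, zero_smul, add_zero] at hg
      induction i using Fin.lastCases with
      | last => exact h
      | cast i => exact Fintype.linearIndependent_iff.1 hmin (fun i => g i.castSucc) hg i
    · have : g (Fin.last m) • w m = -∑ i : Fin m, g i.castSucc • w i :=
        eq_neg_of_add_eq_zero_right hg
      rw [this]
      exact neg_mem (Submodule.sum_mem _ fun i _ =>
        Submodule.smul_mem _ _ (Submodule.subset_span (mem_range_self i)))
  have hWb : ∀ v ∈ W, b • polyConnection D C v ∈ W := by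
    intro v hv
    induction hv using Submodule.span_induction with
    | mem v hv =>
      obtain ⟨i, rfl⟩ := hv
      simp only [hw]
      rcases Nat.lt_or_ge (i + 1) m with h | h
      · exact Submodule.smul_mem _ _ (Submodule.subset_span ⟨⟨i + 1, h⟩, rfl⟩)
      · have : (i : ℕ) + 1 = m := by omega
        rwa [this]
    | zero =>
      have : polyConnection D C 0 = 0 := by
        funext j
        simp [polyConnection]
      simp [this]
    | add v v' _ _ h h' =>
      rw [polyConnection_add, smul_add]
      exact add_mem h h'
    | smul r v hv h =>
      rw [polyConnection_smul, smul_add, smul_comm b r]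
      exact add_mem (Submodule.smul_mem _ _ h)
        (Submodule.smul_mem _ _ (Submodule.smul_mem _ _ hv))
  let L : Submodule (Polynomial ℂ) (Fin n → Polynomial ℂ) :=
    { carrier := {v | ∃ a : Polynomial ℂ, a ≠ 0 ∧ a • v ∈ W}
      zero_mem' := ⟨1, one_ne_zero, by simp⟩
      add_mem' := by
        rintro v v' ⟨a, ha, hav⟩ ⟨a', ha', hav'⟩
        refine ⟨a * a', mul_ne_zero ha ha', ?_⟩
        rw [smul_add, mul_comm, mul_smul, mul_comm, mul_smul]
        exact add_mem (Submodule.smul_mem _ _ hav) (Submodule.smul_mem _ _ hav')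
      smul_mem' := by
        rintro r v ⟨a, ha, hav⟩
        refine ⟨a, ha, ?_⟩
        rw [smul_comm]
        exact Submodule.smul_mem _ _ hav }
  have hLstable : ∀ v ∈ L, polyConnection D C v ∈ L := by
    rintro v ⟨a, ha, hav⟩
    refine ⟨b * a * a, mul_ne_zero (mul_ne_zero hb0 ha) ha, ?_⟩
    have h1 := hWb _ hav
    rw [polyConnection_smul] at h1
    have h2 : (b * a * a) • polyConnection D C v
        = a • b • (a • polyConnection D C v + (D * Polynomial.derivative a) • v)
          - (b * D * Polynomial.derivative a) • a • v := by
      simp only [smul_add, smul_smul]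
      rw [show b * D * Polynomial.derivative a * a = a * (b * (D * Polynomial.derivative a)) by ring,
        show a * (b * a) = b * a * a by ring]
      simp
    rw [h2]
    exact sub_mem (Submodule.smul_mem _ _ h1) (Submodule.smul_mem _ _ hav)
  have hqL : q ∈ L := by
    rcases Nat.eq_zero_or_pos m with h | h
    · subst h
      exact ⟨b, hb0, hb⟩
    · exact ⟨1, one_ne_zero, by
        rw [one_smul]; exact Submodule.subset_span ⟨⟨0, h⟩, rfl⟩⟩
  have hdeg : ∀ (i : Fin m) j, (w i j).natDegree ≤ e + n * c := fun i j =>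
    (natDegree_polyConnection_iterate_le hDc hC hq i j).trans
      (by gcongr; exact i.2.le.trans hmn)
  obtain ⟨Δ, hΔ0, hΔdeg, hΔ⟩ := exists_smul_mem_span_of_linearIndependent hmin hdeg
  have hword : ∀ k N : ℕ, ((N + k : ℕ) : ℕ∞) ≤ analyticOrderAt (polyPairing K q) t₀ →
      (N : ℕ∞) ≤ analyticOrderAt (polyPairing K (w k)) t₀ := by
    intro k
    induction k with
    | zero => exact fun N h => h
    | succ k ih =>
      intro N h
      rw [← hw, analyticOrderAt_congr (polyPairing_polyConnection hK hsys (w k)),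
        analyticOrderAt_eval_mul_of_ne_zero (analyticAt_polyPairing hK _).deriv hD]
      refine natCast_le_analyticOrderAt_deriv (analyticAt_polyPairing hK _) (ih _ ?_)
      rwa [add_right_comm, add_assoc]
  have hLzero : ∀ v ∈ L, polyPairing K v t₀ = 0 := by
    rintro v ⟨a, ha, hav⟩
    obtain ⟨μ, hμ⟩ := (Submodule.mem_span_range_iff_exists_fun _).1 (hΔ a ha v hav)
    have h1 : (fun t => Δ.eval t * polyPairing K v t)
        = fun t => ∑ i, (μ i).eval t * polyPairing K (w i) t := by
      funext t
      have h2 : ∀ j, Δ.eval t * (v j).eval t = ∑ i, (μ i).eval t * (w i j).eval t := by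
        intro j
        have := congrArg (Polynomial.eval t) (congrFun hμ j)
        simpa [Polynomial.eval_finsetSum] using this.symm
      simp only [polyPairing, Finset.mul_sum, ← mul_assoc, h2, Finset.sum_mul]
      exact Finset.sum_comm
    have h2 : ((Δ.natDegree + 1 : ℕ) : ℕ∞)
        ≤ analyticOrderAt (fun t => Δ.eval t * polyPairing K v t) t₀ := by
      rw [h1]
      refine natCast_le_analyticOrderAt_sum _ fun i _ => ?_
      refine (hword i _ (le_trans ?_ hord)).trans
        (le_analyticOrderAt_eval_mul (analyticAt_polyPairing hK _) _)
      have h3 := i.2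
      have h4 : m * (e + n * c) ≤ n * (e + n * c) := Nat.mul_le_mul_right _ hmn
      exact_mod_cast (by omega : Δ.natDegree + 1 + i ≤ n + n * (e + n * c))
    have h3 := analyticOrderAt_mul (analyticAt_eval Δ t₀) (analyticAt_polyPairing hK v)
    by_contra h4
    rw [analyticOrderAt_eq_zero.2 (Or.inr h4), add_zero] at h3
    have h5 := h2.trans (h3.le.trans (analyticOrderAt_eval_le_natDegree hΔ0 t₀))
    norm_cast at h5
    omega
  obtain ⟨S, hS⟩ := IsNoetherian.noetherian L
  have hSL : ∀ v ∈ S, v ∈ L := fun v hv => hS ▸ Submodule.subset_span hv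
  have hT : ∀ v, ∃ T : (Fin n → Polynomial ℂ) → Polynomial ℂ, v ∈ L → ∑ a ∈ S, T a • a = v := by
    intro v
    by_cases hv : v ∈ L
    · rw [← hS] at hv
      obtain ⟨T, -, hT⟩ := Submodule.mem_span_finset.1 hv
      exact ⟨T, fun _ => hT⟩
    · exact ⟨0, fun h => absurd h hv⟩
  choose T hT using hT
  have hpair : ∀ v ∈ L, ∀ t, polyPairing K v t = ∑ a ∈ S, (T v a).eval t * polyPairing K a t := by
    intro v hv t
    conv_lhs => rw [← hT v hv]
    simp only [polyPairing, Finset.sum_apply, Pi.smul_apply, smul_eq_mul, Polynomial.eval_finsetSum,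
      Polynomial.eval_mul, Finset.sum_mul, Finset.mul_sum, mul_assoc]
    exact Finset.sum_comm
  have hzero := eventually_eq_zero_of_linear_system S (u := fun v => polyPairing K v) hD
    (T := fun v => T (polyConnection D C v)) (fun v _ => analyticAt_polyPairing hK v)
    (fun v hv => hLzero v (hSL v hv)) (fun v hv => by
      filter_upwards [polyPairing_polyConnection hK hsys v] with t ht
      rw [← ht]
      exact hpair _ (hLstable v (hSL v hv)) t)
  filter_upwards [(Finset.eventually_all S).2 hzero] with t ht
  rw [hpair q hqL t]
  exact Finset.sum_eq_zero fun a ha => by rw [ht a ha, mul_zero]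

/-- `f` is on `U` a combination of the functions `K i` with polynomial coefficients of degree at
most `N`. -/
def IsPolyCombination {n : ℕ} (U : Set ℂ) (K : Fin n → ℂ → ℂ) (N : ℕ) (f : ℂ → ℂ) : Prop :=
  ∃ q : Fin n → Polynomial ℂ, (∀ i, (q i).natDegree ≤ N) ∧ ∀ t ∈ U, f t = polyPairing K q t

namespace IsPolyCombination

variable {n : ℕ} {U : Set ℂ} {K : Fin n → ℂ → ℂ} {N M : ℕ} {f g : ℂ → ℂ}

theorem mono (hf : IsPolyCombination U K N f) (h : N ≤ M) : IsPolyCombination U K M f :=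
  let ⟨q, hq, hqf⟩ := hf
  ⟨q, fun i => (hq i).trans h, hqf⟩

theorem congr (hf : IsPolyCombination U K N f) (h : ∀ t ∈ U, g t = f t) :
    IsPolyCombination U K N g :=
  let ⟨q, hq, hqf⟩ := hf
  ⟨q, hq, fun t ht => (h t ht).trans (hqf t ht)⟩

theorem add (hf : IsPolyCombination U K N f) (hg : IsPolyCombination U K N g) :
    IsPolyCombination U K N fun t => f t + g t := by
  obtain ⟨q, hq, hqf⟩ := hf
  obtain ⟨r, hr, hrg⟩ := hg
  refine ⟨q + r, fun i => Polynomial.natDegree_add_le_of_degree_le (hq i) (hr i), fun t ht => ?_⟩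
  beta_reduce
  rw [hqf t ht, hrg t ht]
  simp [polyPairing, add_mul, Finset.sum_add_distrib]

theorem eval_mul (hf : IsPolyCombination U K N f) {r : Polynomial ℂ} (hr : r.natDegree ≤ M) :
    IsPolyCombination U K (N + M) fun t => r.eval t * f t := by
  obtain ⟨q, hq, hqf⟩ := hf
  refine ⟨r • q, fun i => ?_, fun t ht => ?_⟩
  · rw [add_comm]
    exact Polynomial.natDegree_mul_le.trans (add_le_add hr (hq i))
  · beta_reduce
    rw [hqf t ht]
    simp [polyPairing, Finset.mul_sum, mul_assoc]

theorem const_mul (hf : IsPolyCombination U K N f) (c : ℂ) :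
    IsPolyCombination U K N fun t => c * f t :=
  (hf.eval_mul (r := Polynomial.C c) (M := 0) (by simp)).congr fun t _ => by simp

theorem zero : IsPolyCombination U K N fun _ => 0 :=
  ⟨0, fun i => by simp, fun t _ => by simp [polyPairing]⟩

theorem sum {ι : Type*} (s : Finset ι) {f : ι → ℂ → ℂ}
    (hf : ∀ i ∈ s, IsPolyCombination U K N (f i)) :
    IsPolyCombination U K N fun t => ∑ i ∈ s, f i t := by
  classical
  induction s using Finset.induction_on with
  | empty => exact zero.congr fun t _ => by simp
  | insert a s ha ih =>
    simp only [Finset.sum_insert ha]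
    exact (hf a (Finset.mem_insert_self a s)).add
      (ih fun i hi => hf i (Finset.mem_insert_of_mem hi))

theorem basis (i : Fin n) : IsPolyCombination U K 0 (K i) :=
  ⟨Pi.single i 1, fun j => by rcases eq_or_ne j i with rfl | h <;> simp [*],
    fun t _ => by
      rw [polyPairing, Finset.sum_eq_single i] <;> simp +contextual⟩

end IsPolyCombination

/-- The formal properties over `U` of the functions `E r k t = ∮ r(x) y ^ k dx` given by a family
of loops in the fibres `y ^ 2 - p(x) = t`. -/
structure IsLoopFunctional (p : Polynomial ℂ) (U : Set ℂ)
    (E : Polynomial ℂ → ℕ → ℂ → ℂ) : Prop where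
  add : ∀ r s k, ∀ t ∈ U, E (r + s) k t = E r k t + E s k t
  const_mul : ∀ c r k, ∀ t ∈ U, E (Polynomial.C c * r) k t = c * E r k t
  mul_sq : ∀ r k, ∀ t ∈ U, E r (k + 2) t = E (p * r) k t + t * E r k t
  exact : ∀ r k, ∀ t ∈ U, 2 * E (Polynomial.derivative r) (k + 2) t
    + (k + 2) * E (r * Polynomial.derivative p) k t = 0
  zero : ∀ r, ∀ t ∈ U, E r 0 t = 0

namespace IsLoopFunctional

open Polynomial

variable {p : ℂ[X]} {U : Set ℂ} {E : ℂ[X] → ℕ → ℂ → ℂ} {n : ℕ}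

theorem even (h : IsLoopFunctional p U E) (r : ℂ[X]) (j : ℕ) {t : ℂ} (ht : t ∈ U) :
    E r (2 * j) t = 0 := by
  induction j generalizing r with
  | zero => exact h.zero r t ht
  | succ j ih =>
    rw [mul_add, mul_one, h.mul_sq r _ t ht, ih, ih, mul_zero, add_zero]

theorem map_zero (h : IsLoopFunctional p U E) (k : ℕ) {t : ℂ} (ht : t ∈ U) : E 0 k t = 0 := by
  simpa using h.const_mul 0 0 k t ht

theorem map_sum (h : IsLoopFunctional p U E) {ι : Type*} (s : Finset ι) (r : ι → ℂ[X]) (k : ℕ)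
    {t : ℂ} (ht : t ∈ U) : E (∑ i ∈ s, r i) k t = ∑ i ∈ s, E (r i) k t := by
  classical
  induction s using Finset.induction_on with
  | empty => simp [h.map_zero k ht]
  | insert a s ha ih => rw [Finset.sum_insert ha, Finset.sum_insert ha, h.add _ _ _ t ht, ih]

theorem isPolyCombination_three (h : IsLoopFunctional p U E) (hn : 1 ≤ n) (hp : p.Monic)
    (hpn : p.natDegree = n + 1) (N : ℕ) :
    ∀ r : ℂ[X], r.natDegree ≤ N →
      IsPolyCombination U (fun (i : Fin n) t => E (X ^ (i : ℕ)) 3 t) N (E r 3) := by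
  induction N using Nat.strong_induction_on with
  | _ N ih =>
  intro r hr
  rcases Nat.lt_or_ge N n with hN | hN
  · refine (IsPolyCombination.sum (N := N) (Finset.range (N + 1))
      (f := fun i t => r.coeff i * E (X ^ i) 3 t) fun i hi => ?_).congr fun t ht => ?_
    · rw [Finset.mem_range] at hi
      exact ((IsPolyCombination.basis (⟨i, by omega⟩ : Fin n)).mono (Nat.zero_le N)).const_mul _
    · conv_lhs => rw [r.as_sum_range_C_mul_X_pow' (Nat.lt_succ_of_le hr)]
      rw [h.map_sum _ _ _ ht]
      exact Finset.sum_congr rfl fun i _ => h.const_mul _ _ _ t ht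
  · obtain ⟨a, rfl⟩ := Nat.exists_eq_add_of_le' hN
    let g : ℂ[X] := C 2 * (p * derivative (X ^ a)) + C 5 * (X ^ a * derivative p)
    have hgE : IsPolyCombination U (fun (i : Fin n) t => E (X ^ (i : ℕ)) 3 t) (a + n) (E g 3) := by
      have h1 : IsPolyCombination U (fun (i : Fin n) t => E (X ^ (i : ℕ)) 3 t) (a + n)
          (fun t => (X : ℂ[X]).eval t * E (derivative (X ^ a)) 3 t) := by
        rcases a with _ | a
        · exact IsPolyCombination.zero.congr fun t ht => by simp [h.map_zero 3 ht]
        · refine ((ih a (by omega) _ ?_).eval_mul (M := 1) natDegree_X_le).mono (by omega)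
          exact (natDegree_derivative_le _).trans (by simp)
      refine (h1.const_mul (-2)).congr fun t ht => ?_
      have h2 := h.exact (X ^ a) 3 t ht
      rw [h.mul_sq _ 3 t ht] at h2
      rw [h.add _ _ _ t ht, h.const_mul _ _ _ t ht, h.const_mul _ _ _ t ht, eval_X]
      push_cast at h2
      linear_combination h2
    have hp' : (derivative p).natDegree ≤ n := by
      have := natDegree_derivative_le p
      omega
    have hpc : p.coeff (n + 1) = 1 := hpn ▸ hp
    have hgN : g.natDegree ≤ a + n := by
      refine natDegree_add_le_of_degree_le ?_ ?_
      · refine (natDegree_C_mul_le _ _).trans ?_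
        rcases a with _ | a
        · simp
        · refine natDegree_mul_le.trans ?_
          have := natDegree_derivative_le (X ^ (a + 1) : ℂ[X])
          rw [natDegree_X_pow] at this
          omega
      · refine (natDegree_C_mul_le _ _).trans (natDegree_mul_le.trans ?_)
        rw [natDegree_X_pow]
        omega
    have hgc : g.coeff (a + n) = 2 * (a : ℂ) + 5 * ((n : ℂ) + 1) := by
      have h1 : (X ^ a * derivative p).coeff (a + n) = (n : ℂ) + 1 := by
        rw [add_comm, coeff_X_pow_mul, coeff_derivative, hpc, one_mul]
      have h2 : (p * derivative (X ^ a)).coeff (a + n) = (a : ℂ) := by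
        rcases a with _ | a
        · simp
        · rw [derivative_X_pow, Nat.add_sub_cancel, mul_left_comm, coeff_C_mul,
            show a + 1 + n = n + 1 + a by omega, coeff_mul_X_pow, hpc, mul_one]
      simp only [g, coeff_add, coeff_C_mul, h1, h2]
    have hgc0 : g.coeff (a + n) ≠ 0 := by
      rw [hgc]
      norm_cast
    let c : ℂ := r.coeff (a + n) / g.coeff (a + n)
    have hs : (r - C c * g).natDegree ≤ a + n - 1 := by
      rw [natDegree_le_iff_coeff_eq_zero]
      intro m hm
      rcases Nat.eq_or_lt_of_le (show a + n ≤ m by omega) with rfl | hm'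
      · simp [c, hgc0]
      · rw [coeff_sub, coeff_C_mul, coeff_eq_zero_of_natDegree_lt (hr.trans_lt hm'),
          coeff_eq_zero_of_natDegree_lt (hgN.trans_lt hm')]
        simp
    refine (((ih (a + n - 1) (by omega) _ hs).mono (by omega)).add (hgE.const_mul c)).congr
      fun t ht => ?_
    rw [← h.const_mul _ _ _ t ht, ← h.add _ _ _ t ht, sub_add_cancel]

theorem isPolyCombination_odd (h : IsLoopFunctional p U E) (hn : 1 ≤ n) (hp : p.Monic)
    (hpn : p.natDegree = n + 1) (j : ℕ) :
    ∀ {N : ℕ} {r : ℂ[X]}, r.natDegree ≤ N →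
      IsPolyCombination U (fun (i : Fin n) t => E (X ^ (i : ℕ)) 3 t) (N + (n + 1) * j)
        (E r (2 * j + 3)) := by
  induction j with
  | zero => exact fun hr => h.isPolyCombination_three hn hp hpn _ _ hr
  | succ j ih =>
    intro N r hr
    have h1 : (p * r).natDegree ≤ N + (n + 1) := by
      have := natDegree_mul_le (p := p) (q := r)
      omega
    refine (((ih h1).mono (le_of_eq (by ring))).add
      (((ih hr).eval_mul (M := 1) natDegree_X_le).mono (by rw [mul_add]; omega))).congr
      fun t ht => ?_
    rw [eval_X]
    exact h.mul_sq r (2 * j + 3) t ht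

theorem isPolyCombination_sub (h : IsLoopFunctional p U E) (hn : 1 ≤ n) (hp : p.Monic)
    (hpn : p.natDegree = n + 1) {ι : Type*} (c : ι → ℂ) (s : Finset ι) {N : ℕ} {r : ℂ[X]}
    (hr : r.natDegree ≤ N) :
    IsPolyCombination U (fun (i : Fin n) t => E (X ^ (i : ℕ)) 3 t) (N + (n + 1) * s.card)
      (fun t => (∏ k ∈ s, (X + C (c k))).eval t * E r 1 t
        - E (r * ∏ k ∈ s, (C (c k) - p)) 1 t) := by
  classical
  induction s using Finset.induction_on with
  | empty => exact IsPolyCombination.zero.congr fun t _ => by simp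
  | insert a s ha ih =>
    have hdeg : ∀ k, (C (c k) - p).natDegree ≤ n + 1 := fun k =>
      (natDegree_sub_le _ _).trans (by simp [hpn])
    have hs : (r * ∏ k ∈ s, (C (c k) - p)).natDegree ≤ N + (n + 1) * s.card := by
      refine natDegree_mul_le.trans (add_le_add hr ((natDegree_prod_le _ _).trans ?_))
      refine (Finset.sum_le_card_nsmul _ _ (n + 1) fun k _ => hdeg k).trans (le_of_eq ?_)
      rw [smul_eq_mul, mul_comm]
    rw [Finset.card_insert_of_notMem ha]
    have h1 : (X + C (c a)).natDegree ≤ 1 := (natDegree_X_add_C _).le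
    refine (((ih.eval_mul h1).mono ?_).add ((h.isPolyCombination_three hn hp hpn _ _ hs).mono
      ?_)).congr fun t ht => ?_
    · rw [mul_add]; omega
    · rw [mul_add]; omega
    · have h2 := h.mul_sq (r * ∏ k ∈ s, (C (c k) - p)) 1 t ht
      have h3 : r * ∏ k ∈ insert a s, (C (c k) - p)
          = C (c a) * (r * ∏ k ∈ s, (C (c k) - p))
            + C (-1) * (p * (r * ∏ k ∈ s, (C (c k) - p))) := by
        rw [Finset.prod_insert ha, C_neg, C_1]
        ring
      rw [h3, h.add _ _ _ t ht, h.const_mul _ _ _ t ht, h.const_mul _ _ _ t ht,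
        Finset.prod_insert ha, Polynomial.eval_mul, h2]
      simp only [eval_add, eval_X, eval_C]
      ring

end IsLoopFunctional

section CriticalValues

open Polynomial

variable {p : ℂ[X]} {n : ℕ}

/-- The product of `p(x_k) - p` over the critical points `x_k` is divisible by `p'`. -/
theorem exists_prod_critical_sub_eq (hp : p.Monic) (hpn : p.natDegree = n + 1)
    {xs : Fin n → ℂ} (hxs : Function.Injective xs) (hcrit : ∀ k, (derivative p).eval (xs k) = 0) :
    ∃ β : ℂ[X], β.natDegree ≤ (n + 1) * n ∧
      ∏ k, (C (p.eval (xs k)) - p) = derivative p * β := by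
  have hpc : (derivative p).coeff n = n + 1 := by
    have : p.coeff (n + 1) = 1 := hpn ▸ hp
    rw [coeff_derivative, this, one_mul]
  have hpc0 : (n : ℂ) + 1 ≠ 0 := Nat.cast_add_one_ne_zero n
  have hp'n : (derivative p).natDegree = n := by
    refine le_antisymm ?_ (le_natDegree_of_ne_zero (hpc ▸ hpc0))
    have := natDegree_derivative_le p
    omega
  have hp'0 : derivative p ≠ 0 := by
    intro h
    rw [h, coeff_zero] at hpc
    exact hpc0 hpc.symm
  have hπdeg : (∏ k, (X - C (xs k))).natDegree = n := by simp
  have hπ : ∏ k, (X - C (xs k)) ∣ derivative p :=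
    Fintype.prod_dvd_of_coprime (fun i j hij => isCoprime_X_sub_C_of_isUnit_sub
      (sub_ne_zero.2 (hxs.ne hij)).isUnit) fun k => dvd_iff_isRoot.2 (hcrit k)
  obtain ⟨c, hc⟩ := hπ
  have hc0 : c ≠ 0 := by
    rintro rfl
    exact hp'0 (by rw [hc, mul_zero])
  have hcdeg : c.natDegree = 0 := by
    have := natDegree_mul (monic_prod_X_sub_C xs Finset.univ).ne_zero hc0
    rw [← hc, hp'n, hπdeg] at this
    omega
  have hdvd : derivative p ∣ ∏ k, (C (p.eval (xs k)) - p) := by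
    have hcu : IsUnit c := by
      rw [eq_C_of_natDegree_eq_zero hcdeg] at hc0 ⊢
      exact isUnit_C.2 (IsUnit.mk0 _ (by simpa using hc0))
    rw [hc]
    exact hcu.mul_right_dvd.2 (Finset.prod_dvd_prod_of_dvd _ _ fun k _ =>
      dvd_iff_isRoot.2 (by simp [IsRoot]))
  obtain ⟨β, hβ⟩ := hdvd
  refine ⟨β, ?_, hβ⟩
  have hdeg : (∏ k, (C (p.eval (xs k)) - p)).natDegree ≤ (n + 1) * n := by
    refine (natDegree_prod_le _ _).trans ((Finset.sum_le_card_nsmul _ _ (n + 1) fun k _ =>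
      (natDegree_sub_le _ _).trans (by simp [hpn])).trans (by simp [mul_comm]))
  rcases eq_or_ne β 0 with rfl | hβ0
  · simp
  · rw [hβ, natDegree_mul hp'0 hβ0] at hdeg
    omega

/-- The polynomial whose roots are the critical values of `y ^ 2 - p(x)`. -/
noncomputable def discriminantPoly (p : ℂ[X]) (xs : Fin n → ℂ) : ℂ[X] :=
  ∏ k, (X + C (p.eval (xs k)))

theorem natDegree_discriminantPoly (p : ℂ[X]) (xs : Fin n → ℂ) :
    (discriminantPoly p xs).natDegree = n := by
  rw [discriminantPoly, natDegree_prod_of_monic _ _ fun k _ => monic_X_add_C _]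
  simp

theorem eval_discriminantPoly_ne_zero {xs : Fin n → ℂ} {t : ℂ}
    (ht : ∀ k, t ≠ -p.eval (xs k)) : (discriminantPoly p xs).eval t ≠ 0 := by
  rw [discriminantPoly, eval_prod, Finset.prod_ne_zero_iff]
  intro k _
  simpa using fun h => ht k (eq_neg_of_add_eq_zero_left h)

namespace IsLoopFunctional

variable {U : Set ℂ} {E : ℂ[X] → ℕ → ℂ → ℂ}

theorem isPolyCombination_discriminant_mul_one (h : IsLoopFunctional p U E) (hn : 1 ≤ n)
    (hp : p.Monic) (hpn : p.natDegree = n + 1) {xs : Fin n → ℂ} (hxs : Function.Injective xs)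
    (hcrit : ∀ k, (derivative p).eval (xs k) = 0) {N : ℕ} {r : ℂ[X]} (hr : r.natDegree ≤ N) :
    IsPolyCombination U (fun (i : Fin n) t => E (X ^ (i : ℕ)) 3 t) (N + (n + 1) * n)
      (fun t => (discriminantPoly p xs).eval t * E r 1 t) := by
  obtain ⟨β, hβ, hβp⟩ := exists_prod_critical_sub_eq hp hpn hxs hcrit
  have h1 := h.isPolyCombination_sub hn hp hpn (fun k => p.eval (xs k)) Finset.univ hr
  rw [Finset.card_fin] at h1
  have h2 : (derivative (r * β)).natDegree ≤ N + (n + 1) * n := by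
    refine (natDegree_derivative_le _).trans ((Nat.sub_le _ _).trans ?_)
    exact natDegree_mul_le.trans (add_le_add hr hβ)
  refine (h1.add ((h.isPolyCombination_three hn hp hpn _ _ h2).const_mul (-2 / 3))).congr
    fun t ht => ?_
  have h3 := h.exact (r * β) 1 t ht
  rw [show r * β * derivative p = r * ∏ k, (C (p.eval (xs k)) - p) by rw [hβp]; ring] at h3
  rw [discriminantPoly]
  push_cast at h3
  linear_combination h3 / 3

theorem isPolyCombination_discriminant_mul (h : IsLoopFunctional p U E) (hn : 1 ≤ n)
    (hp : p.Monic) (hpn : p.natDegree = n + 1) {xs : Fin n → ℂ} (hxs : Function.Injective xs)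
    (hcrit : ∀ k, (derivative p).eval (xs k) = 0) {a k d : ℕ}
    (hd : 2 * a + (n + 1) * k + 2 ≤ 2 * d) :
    IsPolyCombination U (fun (i : Fin n) t => E (X ^ (i : ℕ)) 3 t) (d + (n + 1) * n)
      (fun t => (discriminantPoly p xs).eval t * E (X ^ a) k t) := by
  obtain ⟨j, rfl | rfl⟩ := Nat.even_or_odd' k
  · exact IsPolyCombination.zero.congr fun t ht => by rw [h.even _ _ ht, mul_zero]
  · rcases j with _ | j
    · refine (h.isPolyCombination_discriminant_mul_one hn hp hpn hxs hcrit
        (natDegree_X_pow_le a)).mono ?_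
      omega
    · refine ((h.isPolyCombination_odd hn hp hpn j (natDegree_X_pow_le a)).eval_mul
        (natDegree_discriminantPoly p xs).le).mono ?_
      nlinarith

end IsLoopFunctional

end CriticalValues

/-- A continuous family over `U` of loops `(x t, y t)` in the fibres `y ^ 2 - p(x) = t`, with
velocities `(x' t, y' t)`. -/
structure IsLoopFamily (p : Polynomial ℂ) (U : Set ℂ) (x y x' y' : ℂ → ℝ → ℂ) : Prop where
  continuousOn : ContinuousOn (fun q : ℂ × ℝ => (x q.1 q.2, y q.1 q.2)) (U ×ˢ univ)
  periodic_fst : ∀ t ∈ U, x t 1 = x t 0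
  periodic_snd : ∀ t ∈ U, y t 1 = y t 0
  hasDerivAt_fst : ∀ t ∈ U, ∀ s, HasDerivAt (x t) (x' t s) s
  hasDerivAt_snd : ∀ t ∈ U, ∀ s, HasDerivAt (y t) (y' t s) s
  continuousOn_velocity : ContinuousOn (fun q : ℂ × ℝ => (x' q.1 q.2, y' q.1 q.2)) (U ×ˢ univ)
  sq_eq : ∀ t ∈ U, ∀ s, y t s ^ 2 = p.eval (x t s) + t

/-- The integral `∮ r(x) y ^ k dx`. -/
noncomputable def loopIntegral (x y x' : ℂ → ℝ → ℂ) (r : Polynomial ℂ) (k : ℕ) (t : ℂ) : ℂ :=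
  ∫ s in (0 : ℝ)..1, r.eval (x t s) * y t s ^ k * x' t s

theorem Polynomial.exists_derivative_eq {k : Type*} [Field k] [CharZero k] (r : Polynomial k) :
    ∃ R, Polynomial.derivative R = r := by
  induction r using Polynomial.induction_on' with
  | add r s hr hs =>
    obtain ⟨R, rfl⟩ := hr
    obtain ⟨S, rfl⟩ := hs
    exact ⟨R + S, map_add _ _ _⟩
  | monomial m a =>
    refine ⟨Polynomial.monomial (m + 1) (a / (m + 1)), ?_⟩
    rw [Polynomial.derivative_monomial]
    congr 1
    have : (m : k) + 1 ≠ 0 := Nat.cast_add_one_ne_zero m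
    push_cast
    field_simp

namespace IsLoopFamily

open Polynomial

variable {p : ℂ[X]} {U : Set ℂ} {x y x' y' : ℂ → ℝ → ℂ} {t : ℂ}

theorem continuous_fst (h : IsLoopFamily p U x y x' y') (ht : t ∈ U) : Continuous (x t) :=
  continuous_iff_continuousAt.2 fun s => (h.hasDerivAt_fst t ht s).continuousAt

theorem continuous_snd (h : IsLoopFamily p U x y x' y') (ht : t ∈ U) : Continuous (y t) :=
  continuous_iff_continuousAt.2 fun s => (h.hasDerivAt_snd t ht s).continuousAt

theorem continuous_velocity (h : IsLoopFamily p U x y x' y') (ht : t ∈ U) :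
    Continuous fun s => (x' t s, y' t s) :=
  continuousOn_univ.1 (h.continuousOn_velocity.comp (f := fun s : ℝ => (t, s)) (by fun_prop)
    fun _ _ => ⟨ht, mem_univ _⟩)

theorem intervalIntegrable_dx (h : IsLoopFamily p U x y x' y') (ht : t ∈ U) (r : ℂ[X]) (k : ℕ) :
    IntervalIntegrable (fun s => r.eval (x t s) * y t s ^ k * x' t s)
      MeasureTheory.volume 0 1 :=
  (((r.continuous.comp (h.continuous_fst ht)).mul ((h.continuous_snd ht).pow k)).mul
    (_root_.continuous_fst.comp (h.continuous_velocity ht))).intervalIntegrable _ _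

theorem intervalIntegrable_dy (h : IsLoopFamily p U x y x' y') (ht : t ∈ U) (r : ℂ[X]) (k : ℕ) :
    IntervalIntegrable (fun s => r.eval (x t s) * y t s ^ k * y' t s)
      MeasureTheory.volume 0 1 :=
  (((r.continuous.comp (h.continuous_fst ht)).mul ((h.continuous_snd ht).pow k)).mul
    (_root_.continuous_snd.comp (h.continuous_velocity ht))).intervalIntegrable _ _

theorem hasDerivAt_eval_fst (h : IsLoopFamily p U x y x' y') (ht : t ∈ U) (r : ℂ[X]) (s : ℝ) :
    HasDerivAt (fun s => r.eval (x t s)) ((derivative r).eval (x t s) * x' t s) s :=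
  (r.hasDerivAt (x t s)).comp (h := x t) s (h.hasDerivAt_fst t ht s)

theorem two_mul_snd_mul (h : IsLoopFamily p U x y x' y') (ht : t ∈ U) (s : ℝ) :
    2 * y t s * y' t s = (derivative p).eval (x t s) * x' t s := by
  have h1 := (h.hasDerivAt_snd t ht s).fun_pow 2
  have h2 := (h.hasDerivAt_eval_fst ht p s).add_const t
  have h3 : (fun s => y t s ^ 2) = fun s => p.eval (x t s) + t := funext (h.sq_eq t ht)
  rw [h3] at h1
  simpa using h1.unique h2

theorem integral_dy (h : IsLoopFamily p U x y x' y') (ht : t ∈ U) (r : ℂ[X]) (k : ℕ) :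
    (k + 1) * ∫ s in (0 : ℝ)..1, r.eval (x t s) * y t s ^ k * y' t s
      = -loopIntegral x y x' (derivative r) (k + 1) t := by
  have h1 : ∀ s, HasDerivAt (fun s => r.eval (x t s) * y t s ^ (k + 1))
      ((derivative r).eval (x t s) * y t s ^ (k + 1) * x' t s
        + (k + 1) * (r.eval (x t s) * y t s ^ k * y' t s)) s := fun s =>
    ((h.hasDerivAt_eval_fst ht r s).mul
      ((h.hasDerivAt_snd t ht s).fun_pow (k + 1))).congr_deriv (by
        push_cast [Nat.add_sub_cancel]
        ring)
  have h2 := intervalIntegral.integral_eq_sub_of_hasDerivAt (a := 0) (b := 1) (fun s _ => h1 s)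
    ((h.intervalIntegrable_dx ht (derivative r) (k + 1)).add
      ((h.intervalIntegrable_dy ht r k).const_mul _))
  rw [intervalIntegral.integral_add (h.intervalIntegrable_dx ht (derivative r) (k + 1))
      ((h.intervalIntegrable_dy ht r k).const_mul _), intervalIntegral.integral_const_mul,
    h.periodic_fst t ht, h.periodic_snd t ht, sub_self] at h2
  exact eq_neg_of_add_eq_zero_right h2

theorem isLoopFunctional (h : IsLoopFamily p U x y x' y') :
    IsLoopFunctional p U (loopIntegral x y x') where
  add r s k t ht := by
    simp only [loopIntegral]
    rw [← intervalIntegral.integral_add (h.intervalIntegrable_dx ht r k)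
      (h.intervalIntegrable_dx ht s k)]
    simp only [eval_add, add_mul]
  const_mul c r k t ht := by
    simp only [loopIntegral]
    rw [← intervalIntegral.integral_const_mul]
    simp only [eval_mul, eval_C, mul_assoc]
  mul_sq r k t ht := by
    simp only [loopIntegral]
    rw [← intervalIntegral.integral_const_mul,
      ← intervalIntegral.integral_add (h.intervalIntegrable_dx ht _ k)
        ((h.intervalIntegrable_dx ht r k).const_mul _)]
    refine intervalIntegral.integral_congr fun s _ => ?_
    simp only [eval_mul, pow_add, h.sq_eq t ht s]
    ring
  exact r k t ht := by
    have h1 := h.integral_dy ht r (k + 1)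
    have h2 : 2 * ∫ s in (0 : ℝ)..1, r.eval (x t s) * y t s ^ (k + 1) * y' t s
        = loopIntegral x y x' (r * derivative p) k t := by
      simp only [loopIntegral]
      rw [← intervalIntegral.integral_const_mul]
      refine intervalIntegral.integral_congr fun s _ => ?_
      simp only [eval_mul]
      linear_combination r.eval (x t s) * y t s ^ k * h.two_mul_snd_mul ht s
    push_cast at h1
    linear_combination 2 * h1 - (k + 2) * h2
  zero r t ht := by
    obtain ⟨R, rfl⟩ := r.exists_derivative_eq
    simp only [loopIntegral, pow_zero, mul_one]
    rw [intervalIntegral.integral_eq_sub_of_hasDerivAt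
      (fun s _ => h.hasDerivAt_eval_fst ht R s)
      (by simpa using h.intervalIntegrable_dx ht (derivative R) 0),
      h.periodic_fst t ht, sub_self]

theorem hasDerivAt_loopIntegral_three (h : IsLoopFamily p U x y x' y') (hU : IsOpen U)
    (ht : t ∈ U) (hreg : ∀ z, (derivative p).eval z = 0 → t ≠ -p.eval z) (r : ℂ[X]) :
    HasDerivAt (loopIntegral x y x' r 3) (3 / 2 * loopIntegral x y x' r 1 t) t := by
  have heval : ∀ (r : ℂ[X]) (k : ℕ),
      AnalyticOnNhd ℂ (fun q : ℂ × ℂ => r.eval q.1 * q.2 ^ k) univ := fun r k q _ =>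
    ((analyticAt_eval r q.1).comp (f := fun q : ℂ × ℂ => q.1) analyticAt_fst).mul
      (analyticAt_snd.pow k)
  have hd : ∀ (r : ℂ[X]) (q : ℂ × ℂ), HasFDerivAt (fun q : ℂ × ℂ => r.eval q.1)
      ((derivative r).eval q.1 • ContinuousLinearMap.fst ℂ ℂ ℂ) q := fun r q =>
    (r.hasDerivAt q.1).comp_hasFDerivAt (f := fun q : ℂ × ℂ => q.1) q hasFDerivAt_fst
  have hd2 : ∀ (k : ℕ) (q : ℂ × ℂ), HasFDerivAt (fun q : ℂ × ℂ => q.2 ^ k)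
      ((k * q.2 ^ (k - 1)) • ContinuousLinearMap.snd ℂ ℂ ℂ) q := fun k q =>
    (hasDerivAt_pow k q.2).comp_hasFDerivAt (f := fun q : ℂ × ℂ => q.2) q hasFDerivAt_snd
  have hHan : AnalyticOnNhd ℂ (fun q : ℂ × ℂ => q.2 ^ 2 - p.eval q.1) univ := fun q _ =>
    (analyticAt_snd.pow 2).sub
      ((analyticAt_eval p q.1).comp (f := fun q : ℂ × ℂ => q.1) analyticAt_fst)
  have hHd : ∀ q : ℂ × ℂ, fderiv ℂ (fun q : ℂ × ℂ => q.2 ^ 2 - p.eval q.1) q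
      = ((2 : ℕ) * q.2 ^ (2 - 1)) • ContinuousLinearMap.snd ℂ ℂ ℂ
        - (derivative p).eval q.1 • ContinuousLinearMap.fst ℂ ℂ ℂ := fun q =>
    ((hd2 2 q).sub (hd p q)).fderiv
  have key := hasDerivAt_integral_loop (a := fun q => r.eval q.1 * q.2 ^ 3)
    (b := fun q => (C (3 / 2) * r).eval q.1 * q.2 ^ 1) (γ := fun t s => (x t s, y t s))
    (γ' := fun t s => (x' t s, y' t s)) hHan (heval r 3) (heval (C (3 / 2) * r) 1)
    (fun q => by
      rw [hHd q, ((hd r q).fun_mul (hd2 3 q)).fderiv]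
      simp
      ring)
    hU h.continuousOn (fun t ht => Prod.ext (h.periodic_fst t ht) (h.periodic_snd t ht))
    (fun t ht s => (h.hasDerivAt_fst t ht s).prodMk (h.hasDerivAt_snd t ht s))
    h.continuousOn_velocity (fun t ht s => by simp [h.sq_eq t ht s]) ht
    (fun s h0 => by
      rw [hHd] at h0
      have h1 : y t s = 0 := by simpa using DFunLike.congr_fun h0 (0, 1)
      have h2 : (derivative p).eval (x t s) = 0 := by simpa using DFunLike.congr_fun h0 (1, 0)
      have h3 := h.sq_eq t ht s
      rw [h1] at h3
      exact hreg _ h2 (by linear_combination -h3))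
  refine key.congr_deriv ?_
  simp only [loopIntegral]
  rw [← intervalIntegral.integral_const_mul]
  simp only [eval_mul, eval_C, mul_assoc]

end IsLoopFamily

namespace IsLoopFamily

open Polynomial

variable {p : ℂ[X]} {U : Set ℂ} {x y x' y' : ℂ → ℝ → ℂ} {t : ℂ}

/-- The integral of the `1`-form `P dx + Q dy` in terms of the integrals `∮ r(x) y ^ k dx`. -/
theorem integral_form (h : IsLoopFamily p U x y x' y') (ht : t ∈ U) (P Q : MvPolynomial (Fin 2) ℂ) :
    ∫ s in (0 : ℝ)..1, (MvPolynomial.eval ![x t s, y t s] P * x' t s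
        + MvPolynomial.eval ![x t s, y t s] Q * y' t s)
      = ∑ m ∈ P.support, P.coeff m * loopIntegral x y x' (X ^ m 0) (m 1) t
        + ∑ m ∈ Q.support, -(Q.coeff m / (m 1 + 1))
          * loopIntegral x y x' (derivative (X ^ m 0)) (m 1 + 1) t := by
  have heval : ∀ (R : MvPolynomial (Fin 2) ℂ) (s : ℝ) (z : ℂ),
      MvPolynomial.eval ![x t s, y t s] R * z
        = ∑ m ∈ R.support, R.coeff m * ((X ^ m 0 : ℂ[X]).eval (x t s) * y t s ^ m 1 * z) := by
    intro R s z
    rw [MvPolynomial.eval_eq', Finset.sum_mul]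
    refine Finset.sum_congr rfl fun m _ => ?_
    simp [Fin.prod_univ_two, mul_assoc]
  have hx : ∀ m ∈ P.support, IntervalIntegrable
      (fun s => P.coeff m * ((X ^ m 0 : ℂ[X]).eval (x t s) * y t s ^ m 1 * x' t s))
      MeasureTheory.volume 0 1 := fun m _ => (h.intervalIntegrable_dx ht _ _).const_mul _
  have hy : ∀ m ∈ Q.support, IntervalIntegrable
      (fun s => Q.coeff m * ((X ^ m 0 : ℂ[X]).eval (x t s) * y t s ^ m 1 * y' t s))
      MeasureTheory.volume 0 1 := fun m _ => (h.intervalIntegrable_dy ht _ _).const_mul _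
  simp only [heval]
  rw [intervalIntegral.integral_add (by simpa only [Finset.sum_fn] using IntervalIntegrable.sum _ hx)
    (by simpa only [Finset.sum_fn] using IntervalIntegrable.sum _ hy),
    intervalIntegral.integral_finsetSum hx, intervalIntegral.integral_finsetSum hy]
  congr 1
  · exact Finset.sum_congr rfl fun m _ => intervalIntegral.integral_const_mul _ _
  · refine Finset.sum_congr rfl fun m _ => ?_
    rw [intervalIntegral.integral_const_mul]
    have h1 := h.integral_dy ht (X ^ m 0) (m 1)
    have h2 : (m 1 : ℂ) + 1 ≠ 0 := Nat.cast_add_one_ne_zero _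
    field_simp
    linear_combination Q.coeff m * h1

theorem isPolyCombination_form {n d : ℕ} (h : IsLoopFamily p U x y x' y') (hn : 1 ≤ n)
    (hp : p.Monic) (hpn : p.natDegree = n + 1) {xs : Fin n → ℂ} (hxs : Function.Injective xs)
    (hcrit : ∀ k, (derivative p).eval (xs k) = 0) {P Q : MvPolynomial (Fin 2) ℂ}
    (hP : ∀ m ∈ P.support, 2 * m 0 + (n + 1) * m 1 + 2 ≤ 2 * d)
    (hQ : ∀ m ∈ Q.support, 2 * m 0 + (n + 1) * m 1 + (n + 1) ≤ 2 * d) :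
    IsPolyCombination U (fun (i : Fin n) t => loopIntegral x y x' (X ^ (i : ℕ)) 3 t)
      (d + (n + 1) * n) (fun t => (discriminantPoly p xs).eval t *
        ∫ s in (0 : ℝ)..1, (MvPolynomial.eval ![x t s, y t s] P * x' t s
          + MvPolynomial.eval ![x t s, y t s] Q * y' t s)) := by
  have hE := h.isLoopFunctional
  have h1 := IsPolyCombination.sum P.support fun m hm =>
    (hE.isPolyCombination_discriminant_mul hn hp hpn hxs hcrit (hP m hm)).const_mul (P.coeff m)
  have h2 := IsPolyCombination.sum (U := U)
    (K := fun (i : Fin n) t => loopIntegral x y x' (X ^ (i : ℕ)) 3 t) (N := d + (n + 1) * n)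
    Q.support (f := fun m t => -(Q.coeff m / (m 1 + 1)) * ((discriminantPoly p xs).eval t
      * loopIntegral x y x' (derivative (X ^ m 0)) (m 1 + 1) t)) fun m hm => by
    rcases ha : m 0 with _ | a
    · refine IsPolyCombination.zero.congr fun t ht => ?_
      rw [pow_zero, derivative_one, hE.map_zero _ ht, mul_zero, mul_zero]
    · have hd : 2 * a + (n + 1) * (m 1 + 1) + 2 ≤ 2 * d := by
        have := hQ m hm
        rw [ha] at this
        linarith
      refine (((hE.isPolyCombination_discriminant_mul hn hp hpn hxs hcrit hd).const_mul
        ((a : ℂ) + 1)).const_mul (-(Q.coeff m / (m 1 + 1)))).congr fun t ht => ?_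
      rw [derivative_X_pow, hE.const_mul _ _ _ t ht]
      push_cast [Nat.add_sub_cancel]
      ring
  refine (h1.add h2).congr fun t ht => ?_
  rw [h.integral_form ht, mul_add, Finset.mul_sum, Finset.mul_sum]
  congr 1 <;> exact Finset.sum_congr rfl fun m _ => mul_left_comm _ _ _

end IsLoopFamily

/-- An integral of a polynomial `1`-form whose order at a regular value is large with respect to
the weighted degree of the form vanishes identically. -/
theorem IsLoopFamily.analyticAt_and_eventually_eq_zero {p : Polynomial ℂ} {U : Set ℂ}
    {x y x' y' : ℂ → ℝ → ℂ} {n d : ℕ} (h : IsLoopFamily p U x y x' y') (hn : 1 ≤ n)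
    (hp : p.Monic) (hpn : p.natDegree = n + 1) {xs : Fin n → ℂ} (hxs : Function.Injective xs)
    (hcrit : ∀ k, (Polynomial.derivative p).eval (xs k) = 0) (hU : IsOpen U)
    (hreg : ∀ t ∈ U, ∀ k, t ≠ -p.eval (xs k)) {P Q : MvPolynomial (Fin 2) ℂ}
    (hP : ∀ m ∈ P.support, 2 * m 0 + (n + 1) * m 1 + 2 ≤ 2 * d)
    (hQ : ∀ m ∈ Q.support, 2 * m 0 + (n + 1) * m 1 + (n + 1) ≤ 2 * d)
    {I : ℂ → ℂ} (hI : ∀ t, I t = ∫ s in (0 : ℝ)..1, (MvPolynomial.eval ![x t s, y t s] P * x' t s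
      + MvPolynomial.eval ![x t s, y t s] Q * y' t s)) {t₀ : ℂ} (ht₀ : t₀ ∈ U) :
    AnalyticAt ℂ I t₀ ∧
      (((n + n * (d + (n + 1) * n + n * (n + (n + 1) * n)) : ℕ) : ℕ∞) ≤ analyticOrderAt I t₀ →
        ∀ᶠ t in 𝓝 t₀, I t = 0) := by
  have hUt : ∀ᶠ t in 𝓝 t₀, t ∈ U := hU.mem_nhds ht₀
  have hcrit' : ∀ z, (Polynomial.derivative p).eval z = 0 → ∃ k, z = xs k := by
    intro z hz
    by_contra! hne
    have h0 : Polynomial.derivative p = 0 := by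
      refine Polynomial.eq_zero_of_natDegree_lt_card_of_eval_eq_zero _
        (f := (Fin.cons z xs : Fin (n + 1) → ℂ))
        (Fin.cons_injective_iff.2 ⟨fun ⟨k, hk⟩ => hne k hk.symm, hxs⟩) (fun i => ?_) ?_
      · induction i using Fin.cases with
        | zero => exact hz
        | succ k => exact hcrit k
      · have := Polynomial.natDegree_derivative_le p
        rw [Fintype.card_fin]
        omega
    have := Polynomial.derivative_eq_zero.1 h0
    omega
  have hreg' : ∀ t ∈ U, ∀ z, (Polynomial.derivative p).eval z = 0 → t ≠ -p.eval z := by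
    intro t ht z hz
    obtain ⟨k, rfl⟩ := hcrit' z hz
    exact hreg t ht k
  let K : Fin n → ℂ → ℂ := fun i t => loopIntegral x y x' (Polynomial.X ^ (i : ℕ)) 3 t
  have hKd : ∀ i, ∀ t ∈ U, HasDerivAt (K i)
      (3 / 2 * loopIntegral x y x' (Polynomial.X ^ (i : ℕ)) 1 t) t := fun i t ht =>
    h.hasDerivAt_loopIntegral_three hU ht (hreg' t ht) _
  have hK : ∀ i, AnalyticAt ℂ (K i) t₀ := fun i =>
    DifferentiableOn.analyticAt (s := U)
      (fun t ht => (hKd i t ht).differentiableAt.differentiableWithinAt) (hU.mem_nhds ht₀)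
  have hD : (discriminantPoly p xs).eval t₀ ≠ 0 := eval_discriminantPoly_ne_zero (hreg t₀ ht₀)
  have hC : ∀ i : Fin n, ∃ C : Fin n → Polynomial ℂ,
      (∀ j, (C j).natDegree ≤ n + (n + 1) * n) ∧ ∀ t ∈ U, (discriminantPoly p xs).eval t
        * (3 / 2 * loopIntegral x y x' (Polynomial.X ^ (i : ℕ)) 1 t) = polyPairing K C t := by
    intro i
    exact (((h.isLoopFunctional.isPolyCombination_discriminant_mul_one hn hp hpn hxs hcrit
      ((Polynomial.natDegree_X_pow_le (i : ℕ)).trans i.2.le)).const_mul (3 / 2)).congr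
        fun t _ => mul_left_comm _ _ _)
  choose C hCdeg hC using hC
  have hsys : ∀ᶠ t in 𝓝 t₀, ∀ i, (discriminantPoly p xs).eval t * deriv (K i) t
      = ∑ j, (C i j).eval t * K j t := by
    filter_upwards [hUt] with t ht i
    rw [(hKd i t ht).deriv]
    exact hC i t ht
  obtain ⟨q, hq, hqI⟩ := h.isPolyCombination_form hn hp hpn hxs hcrit hP hQ
  have hDI : ∀ᶠ t in 𝓝 t₀, (discriminantPoly p xs).eval t * I t = polyPairing K q t := by
    filter_upwards [hUt] with t ht
    rw [hI]
    exact hqI t ht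
  have hDt : ∀ᶠ t in 𝓝 t₀, (discriminantPoly p xs).eval t ≠ 0 :=
    hUt.mono fun t ht => eval_discriminantPoly_ne_zero (hreg t ht)
  have hIan : AnalyticAt ℂ I t₀ := by
    refine ((analyticAt_polyPairing hK q).div (analyticAt_eval _ t₀) hD).congr ?_
    filter_upwards [hDI, hDt] with t h1 h2
    rw [Pi.div_apply, ← h1, mul_div_cancel_left₀ _ h2]
  refine ⟨hIan, fun hord => ?_⟩
  have hzero := polyPairing_eventually_eq_zero hD
    ((natDegree_discriminantPoly p xs).le.trans (Nat.le_add_right n ((n + 1) * n)))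
    hCdeg hK hsys hq (by
      rw [← analyticOrderAt_congr hDI, analyticOrderAt_eval_mul_of_ne_zero hIan hD]
      exact hord)
  filter_upwards [hDI, hDt, hzero] with t h1 h2 h3
  rw [h3] at h1
  exact (mul_eq_zero.1 h1).resolve_left h2

end LoopIntegrals

/-- for each `n ≥ 2` there are constants `A(n)`, `B(n)` such that, for every
Morse-type hyperelliptic `H = y² − x^{n+1} + H̄(x)`, every polynomial 1-form
`ω = P dx + Q dy` of weighted degree ≤ d (weights `w_x = 1`, `w_y = (n+1)/2`, encoded by
doubling: `2a + b(n+1) + 2 ≤ 2d` on monomials `x^a y^b` of `P`, and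
`2a + b(n+1) + (n+1) ≤ 2d` on those of `Q`), every regular value `t₀` and every continuous
family of loops `δ(t)` in the fibres over a neighbourhood of `t₀`, the integral
`I(t) = ∮_{δ(t)} ω` is analytic near `t₀` and, if `I ≢ 0`, `ord_{t₀} I ≤ A(n) + d·B(n)`. -/
theorem ord_abelian_integral_affine_in_degree
    (n : ℕ) (hn : 2 ≤ n) :
    ∃ A B : ℕ,
      ∀ (Hbar : Polynomial ℂ), Hbar.natDegree ≤ n - 1 →
      ∀ (xs : Fin n → ℂ), Function.Injective xs →
      (∀ k, (Polynomial.derivative (Polynomial.X ^ (n + 1) - Hbar)).eval (xs k) = 0) →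
      (Function.Injective fun k => -((Polynomial.X ^ (n + 1) - Hbar).eval (xs k))) →
      ∀ (d : ℕ) (P Q : MvPolynomial (Fin 2) ℂ),
      (∀ m ∈ P.support, 2 * m 0 + (n + 1) * m 1 + 2 ≤ 2 * d) →
      (∀ m ∈ Q.support, 2 * m 0 + (n + 1) * m 1 + (n + 1) ≤ 2 * d) →
      ∀ (t₀ : ℂ) (U : Set ℂ), IsOpen U → IsConnected U → t₀ ∈ U →
      (∀ t ∈ U, ∀ k, t ≠ -((Polynomial.X ^ (n + 1) - Hbar).eval (xs k))) →
      ∀ (δx δy δx' δy' : ℂ → ℝ → ℂ),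
      ContinuousOn (fun q : ℂ × ℝ => (δx q.1 q.2, δy q.1 q.2)) (U ×ˢ Set.univ) →
      (∀ t ∈ U, ∀ s : ℝ, δx t (s + 1) = δx t s ∧ δy t (s + 1) = δy t s) →
      (∀ t ∈ U, ∀ s : ℝ, HasDerivAt (δx t) (δx' t s) s) →
      (∀ t ∈ U, ∀ s : ℝ, HasDerivAt (δy t) (δy' t s) s) →
      ContinuousOn (fun q : ℂ × ℝ => (δx' q.1 q.2, δy' q.1 q.2)) (U ×ˢ Set.univ) →
      (∀ t ∈ U, ∀ s : ℝ,
        (δy t s) ^ 2 - (δx t s) ^ (n + 1) + Hbar.eval (δx t s) = t) →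
      ∀ I : ℂ → ℂ,
      (∀ t, I t = ∫ s in (0:ℝ)..1,
        MvPolynomial.eval ![δx t s, δy t s] P * δx' t s
          + MvPolynomial.eval ![δx t s, δy t s] Q * δy' t s) →
      AnalyticAt ℂ I t₀ ∧
        ((¬ ∀ᶠ t in nhds t₀, I t = 0) → ordAt I t₀ ≤ A + d * B) := by
  refine ⟨n + n * ((n + 1) * n + n * (n + (n + 1) * n)), n, ?_⟩
  intro Hbar hHbar xs hxs hcrit _ d P Q hP hQ t₀ U hU _ ht₀ hreg δx δy δx' δy' hcont hper hdx hdy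
    hcont' hH I hI
  have hdeg : Hbar.natDegree < (Polynomial.X ^ (n + 1) : Polynomial ℂ).natDegree := by
    rw [Polynomial.natDegree_X_pow]
    omega
  have hp : (Polynomial.X ^ (n + 1) - Hbar).Monic :=
    (Polynomial.monic_X_pow (n + 1)).sub_of_left (Polynomial.degree_lt_degree hdeg)
  have hpn : (Polynomial.X ^ (n + 1) - Hbar).natDegree = n + 1 := by
    rw [Polynomial.natDegree_sub_eq_left_of_natDegree_lt hdeg, Polynomial.natDegree_X_pow]
  have hfam : IsLoopFamily (Polynomial.X ^ (n + 1) - Hbar) U δx δy δx' δy' :=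
    { continuousOn := hcont
      periodic_fst := fun t ht => by simpa using (hper t ht 0).1
      periodic_snd := fun t ht => by simpa using (hper t ht 0).2
      hasDerivAt_fst := hdx
      hasDerivAt_snd := hdy
      continuousOn_velocity := hcont'
      sq_eq := fun t ht s => by
        simp only [Polynomial.eval_sub, Polynomial.eval_pow, Polynomial.eval_X]
        linear_combination hH t ht s }
  obtain ⟨hIan, hIzero⟩ := hfam.analyticAt_and_eventually_eq_zero (by omega) hp hpn hxs hcrit hU
    hreg hP hQ hI ht₀
  refine ⟨hIan, fun hne => ?_⟩
  have hord := mt hIzero hne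
  rw [natCast_le_analyticOrderAt_iff_iteratedDeriv_eq_zero hIan] at hord
  push Not at hord
  obtain ⟨k, hk, hk0⟩ := hord
  refine (Nat.sInf_le hk0).trans (hk.le.trans (le_of_eq ?_))
  ring
end

section
/- Let t_0 ∈ ℂ, let P ∈ ℂ[t] be a polynomial with P(t_0) ≠ 0, and let D denote the derivation Df = P·(df/dt). Let l ≥ 1, let Δ ∈ ℂ[t] be a nonzero polynomial, and for each integer k ≥ l let p_{0,k}, …, p_{l−1,k} ∈ ℂ[t] be polynomials. Suppose y is analytic in a neighbourhood of t_0, not identically zero, and satisfies, for every k ≥ l and in a neighbourhood of t_0, the linear differential equation Δ·D^k y = Σ_{i=0}^{l−1} p_{i,k}·D^i y. Then ord_{t_0} y ≤ l−1 + ord_{t_0} Δ. -/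
open scoped BigOperators

/-- The derivation `D f = P · f'` associated to a polynomial `P`. -/
noncomputable def DopP (P : Polynomial ℂ) (f : ℂ → ℂ) : ℂ → ℂ := fun t => P.eval t * deriv f t

/-- A polynomial vanishes at `t₀` as an analytic function to order its root multiplicity. -/
lemma Polynomial.analyticOrderAt_eval_eq_rootMultiplicity {Q : Polynomial ℂ} (hQ : Q ≠ 0) (t₀ : ℂ) :
    analyticOrderAt (fun t => Q.eval t) t₀ = Q.rootMultiplicity t₀ := by
  obtain ⟨q, hq, hdvd⟩ := Q.exists_eq_pow_rootMultiplicity_mul_and_not_dvd hQ t₀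
  rw [(AnalyticOnNhd.eval_polynomial Q t₀ trivial).analyticOrderAt_eq_natCast]
  refine ⟨fun t => q.eval t, AnalyticOnNhd.eval_polynomial q t₀ trivial, ?_, .of_forall fun t => ?_⟩
  · rwa [Polynomial.dvd_iff_isRoot] at hdvd
  · conv_lhs => rw [hq]
    simp

lemma AnalyticAt.DopP {f : ℂ → ℂ} {t₀ : ℂ} (hf : AnalyticAt ℂ f t₀) (P : Polynomial ℂ) :
    AnalyticAt ℂ (DopP P f) t₀ :=
  (AnalyticOnNhd.eval_polynomial P t₀ trivial).mul hf.deriv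

lemma AnalyticAt.iterate_DopP {f : ℂ → ℂ} {t₀ : ℂ} (hf : AnalyticAt ℂ f t₀) (P : Polynomial ℂ)
    (k : ℕ) : AnalyticAt ℂ ((_root_.DopP P)^[k] f) t₀ := by
  induction k with
  | zero => exact hf
  | succ k ih => simpa only [Function.iterate_succ_apply'] using ih.DopP P

/-- Applying `D = P · d/dt` with `P(t₀) ≠ 0` lowers a positive order of vanishing by one. -/
lemma analyticOrderAt_DopP {f : ℂ → ℂ} {t₀ : ℂ} (hf : AnalyticAt ℂ f t₀) {P : Polynomial ℂ}
    (hP : P.eval t₀ ≠ 0) {n : ℕ} (hn : analyticOrderAt f t₀ = n + 1) :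
    analyticOrderAt (DopP P f) t₀ = n := by
  have hPa : AnalyticAt ℂ (fun t => P.eval t) t₀ := AnalyticOnNhd.eval_polynomial P t₀ trivial
  change analyticOrderAt ((fun t => P.eval t) * deriv f) t₀ = n
  rw [analyticOrderAt_mul hPa hf.deriv, hPa.analyticOrderAt_eq_zero.2 hP, zero_add]
  exact analyticOrderAt_deriv_of_pos hf hn

lemma analyticOrderAt_iterate_DopP {f : ℂ → ℂ} {t₀ : ℂ} (hf : AnalyticAt ℂ f t₀)
    {P : Polynomial ℂ} (hP : P.eval t₀ ≠ 0) {n k : ℕ} (hn : analyticOrderAt f t₀ = (n + k : ℕ)) :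
    analyticOrderAt ((DopP P)^[k] f) t₀ = n := by
  induction k generalizing n with
  | zero => exact hn
  | succ k ih =>
    rw [Function.iterate_succ_apply']
    refine analyticOrderAt_DopP (hf.iterate_DopP P k) hP ?_
    exact_mod_cast ih (n := n + 1) (by rw [hn]; congr 1; omega)

lemma ordAt_le_of_analyticOrderAt_eq {f : ℂ → ℂ} {t₀ : ℂ} (hf : AnalyticAt ℂ f t₀) {n : ℕ}
    (hn : analyticOrderAt f t₀ = n) : ordAt f t₀ ≤ n :=
  Nat.sInf_le ((analyticOrderAt_eq_nat_iff_iteratedDeriv_eq_zero hf).1 hn).2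

/-- if `y` is analytic near `t₀`, not identically zero, and satisfies near `t₀`
the equations `Δ · D^k y = ∑_{i<l} p_{i,k} · D^i y` for every `k ≥ l`, where `D f = P·f'`
and `P(t₀) ≠ 0`, then `ord_{t₀} y ≤ l − 1 + ord_{t₀} Δ`. -/
theorem ord_le_of_differential_equations
    (t₀ : ℂ) (P : Polynomial ℂ) (hP : P.eval t₀ ≠ 0)
    (l : ℕ) (hl : 1 ≤ l) (Δ : Polynomial ℂ) (hΔ : Δ ≠ 0)
    (p : Fin l → ℕ → Polynomial ℂ)
    (y : ℂ → ℂ) (hy : AnalyticAt ℂ y t₀) (hy0 : ¬ ∀ᶠ t in nhds t₀, y t = 0)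
    (heq : ∀ k, l ≤ k → ∀ᶠ t in nhds t₀,
      Δ.eval t * (DopP P)^[k] y t = ∑ i : Fin l, (p i k).eval t * (DopP P)^[(i : ℕ)] y t) :
    ordAt y t₀ ≤ l - 1 + Δ.rootMultiplicity t₀ := by
  obtain ⟨n, hn⟩ := ENat.ne_top_iff_exists.1 (mt analyticOrderAt_eq_top.1 hy0)
  refine (ordAt_le_of_analyticOrderAt_eq hy hn.symm).trans ?_
  by_contra! hlt
  have hΔa : AnalyticAt ℂ (fun t => Δ.eval t) t₀ := AnalyticOnNhd.eval_polynomial Δ t₀ trivial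
  have hleft : analyticOrderAt (fun t => Δ.eval t * (DopP P)^[n] y t) t₀
      = Δ.rootMultiplicity t₀ := by
    change analyticOrderAt ((fun t => Δ.eval t) * (DopP P)^[n] y) t₀ = _
    rw [analyticOrderAt_mul hΔa (hy.iterate_DopP P n),
      Polynomial.analyticOrderAt_eval_eq_rootMultiplicity hΔ,
      analyticOrderAt_iterate_DopP (n := 0) hy hP (by rw [zero_add, hn])]
    simp
  have hright : ((n - (l - 1) : ℕ) : ℕ∞) ≤ analyticOrderAt
      (fun t => ∑ i : Fin l, (p i n).eval t * (DopP P)^[(i : ℕ)] y t) t₀ := by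
    have hfun : (fun t => ∑ i : Fin l, (p i n).eval t * (DopP P)^[(i : ℕ)] y t)
        = ∑ i : Fin l, (fun t => (p i n).eval t) * (DopP P)^[(i : ℕ)] y := by
      ext t
      simp
    rw [hfun]
    refine Finset.sum_induction _ (fun g => ((n - (l - 1) : ℕ) : ℕ∞) ≤ analyticOrderAt g t₀)
      (fun f g hf hg => (le_min hf hg).trans le_analyticOrderAt_add) ?_ fun i _ => ?_
    · rw [analyticOrderAt_eq_top.2 (.of_forall (Pi.zero_apply (M := fun _ : ℂ => ℂ)))]
      exact le_top
    · rw [analyticOrderAt_mul (AnalyticOnNhd.eval_polynomial (p i n) t₀ trivial)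
        (hy.iterate_DopP P i), analyticOrderAt_iterate_DopP (n := n - i) hy hP
        (by rw [← hn]; congr 1; omega)]
      exact le_add_left (by exact_mod_cast (by omega : n - (l - 1) ≤ n - i))
  rw [← analyticOrderAt_congr (heq n (by omega)), hleft, Nat.cast_le] at hright
  omega
end

section
/- Let y_1, …, y_l be functions analytic in a neighbourhood of t_0 ∈ ℂ that are linearly independent over ℂ, and let W = W(y_1, …, y_l) be their Wronskian determinant (so W is analytic and not identically zero near t_0). Then for every function y in the ℂ-linear span of y_1, …, y_l that is not identically zero, one has ord_{t_0} W ≥ ord_{t_0} y − (l−1); equivalently, ord_{t_0} y ≤ l−1 + ord_{t_0} W. -/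
open scoped BigOperators

/-- The Wronskian determinant `W(y₁, …, y_l)(t) = det(y_j^{(k)}(t))`. -/
noncomputable def wronskian {l : ℕ} (y : Fin l → ℂ → ℂ) : ℂ → ℂ :=
  fun t => (Matrix.of fun k j : Fin l => iteratedDeriv (k : ℕ) (y j) t).det

open Filter Topology

theorem AnalyticAt.iteratedDeriv_of_complete {f : ℂ → ℂ} {t : ℂ} (hf : AnalyticAt ℂ f t) (n : ℕ) :
    AnalyticAt ℂ (iteratedDeriv n f) t := by
  rw [iteratedDeriv_eq_iterate]
  exact hf.iterated_deriv n

theorem AnalyticAt.matrix_det {n : Type*} [Fintype n] [DecidableEq n] {M : ℂ → Matrix n n ℂ}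
    {t : ℂ} (hM : ∀ i j, AnalyticAt ℂ (fun s => M s i j) t) :
    AnalyticAt ℂ (fun s => (M s).det) t := by
  simp only [Matrix.det_apply']
  exact Finset.analyticAt_fun_sum _ fun σ _ =>
    analyticAt_const.mul (Finset.analyticAt_fun_prod _ fun i _ => hM _ _)

theorem AnalyticAt.matrix_adjugate {n : Type*} [Fintype n] [DecidableEq n]
    {M : ℂ → Matrix n n ℂ} {t : ℂ} (hM : ∀ i j, AnalyticAt ℂ (fun s => M s i j) t) (i j : n) :
    AnalyticAt ℂ (fun s => (M s).adjugate i j) t := by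
  simp only [Matrix.adjugate_apply]
  refine AnalyticAt.matrix_det fun a b => ?_
  by_cases h : a = j
  · simpa [Matrix.updateRow_apply, h] using analyticAt_const
  · simpa [Matrix.updateRow_apply, h] using hM a b

theorem AnalyticAt.wronskian {l : ℕ} {y : Fin l → ℂ → ℂ} {t : ℂ}
    (hy : ∀ j, AnalyticAt ℂ (y j) t) : AnalyticAt ℂ (wronskian y) t :=
  AnalyticAt.matrix_det fun k j => (hy j).iteratedDeriv_of_complete k

/-- If the Wronskian of `y₁, …, y_{l+1}` vanishes near `t` and that of `y₁, …, y_l` does not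
vanish at `t`, then `y₁, …, y_{l+1}` are linearly dependent near `t`. -/
theorem exists_eventually_sum_eq_zero_of_wronskian_castSucc_ne_zero {l : ℕ}
    {y : Fin (l + 1) → ℂ → ℂ} {t : ℂ} (hy : ∀ j, AnalyticAt ℂ (y j) t)
    (hW : ∀ᶠ s in 𝓝 t, wronskian y s = 0)
    (hW' : wronskian (fun j : Fin l => y j.castSucc) t ≠ 0) :
    ∃ c : Fin (l + 1) → ℂ, c ≠ 0 ∧ ∀ᶠ s in 𝓝 t, ∑ j, c j * y j s = 0 := by
  set M : ℂ → Matrix (Fin (l + 1)) (Fin (l + 1)) ℂ :=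
    fun s => Matrix.of fun k j => iteratedDeriv (k : ℕ) (y j) s
  set v : Fin (l + 1) → ℂ → ℂ := fun j s => (M s).adjugate j (Fin.last l) with hv
  have hv_last : ∀ s, v (Fin.last l) s = wronskian (fun j : Fin l => y j.castSucc) s := by
    intro s
    simp only [hv, Matrix.adjugate_fin_succ_eq_det_submatrix, wronskian, Fin.succAbove_last]
    rw [Even.neg_one_pow ⟨_, rfl⟩, one_mul]
    rfl
  have hnear : ∀ᶠ s in 𝓝 t, (∀ j, AnalyticAt ℂ (y j) s) ∧ wronskian y s = 0 ∧
      v (Fin.last l) s ≠ 0 := by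
    refine (eventually_all.2 fun j => (hy j).eventually_analyticAt).and (hW.and ?_)
    simp only [hv_last]
    exact (AnalyticAt.wronskian fun j => hy _).continuousAt.eventually_ne hW'
  obtain ⟨ε, hε, hball⟩ := Metric.eventually_nhds_iff_ball.1 hnear
  set a : Fin (l + 1) → ℂ → ℂ := fun j s => v j s / v (Fin.last l) s with ha
  have hv_an : ∀ s ∈ Metric.ball t ε, ∀ j, AnalyticAt ℂ (v j) s := fun s hs j =>
    AnalyticAt.matrix_adjugate (fun i k => ((hball s hs).1 k).iteratedDeriv_of_complete i) _ _
  have ha_an : ∀ s ∈ Metric.ball t ε, ∀ j, AnalyticAt ℂ (a j) s := fun s hs j =>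
    (hv_an s hs j).div (hv_an s hs _) (hball s hs).2.2
  have ha_last : ∀ s ∈ Metric.ball t ε, a (Fin.last l) s = 1 := fun s hs =>
    div_self (hball s hs).2.2
  have hsum : ∀ s ∈ Metric.ball t ε, ∀ k : Fin (l + 1),
      ∑ j, iteratedDeriv (k : ℕ) (y j) s * a j s = 0 := by
    intro s hs k
    have h := congrFun (congrFun (Matrix.mul_adjugate (M s)) k) (Fin.last l)
    rw [show (M s).det = 0 from (hball s hs).2.1, zero_smul, Matrix.mul_apply] at h
    simp only [ha, mul_div_assoc', ← Finset.sum_div]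
    rw [div_eq_zero_iff]
    exact Or.inl h
  have ha_deriv : ∀ s ∈ Metric.ball t ε, ∀ j, deriv (a j) s = 0 := by
    intro s hs
    have hmem : ∀ᶠ r in 𝓝 s, r ∈ Metric.ball t ε := Metric.isOpen_ball.mem_nhds hs
    have hlast : deriv (a (Fin.last l)) s = 0 := by
      have : a (Fin.last l) =ᶠ[𝓝 s] fun _ => 1 := hmem.mono ha_last
      rw [this.deriv_eq, deriv_const]
    have hsum_deriv : ∀ k : Fin l,
        ∑ j, iteratedDeriv (k : ℕ) (y j) s * deriv (a j) s = 0 := by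
      intro k
      have h₁ : HasDerivAt (fun r => ∑ j, iteratedDeriv (k : ℕ) (y j) r * a j r)
          (∑ j, (iteratedDeriv (k + 1 : ℕ) (y j) s * a j s +
            iteratedDeriv (k : ℕ) (y j) s * deriv (a j) s)) s := by
        refine HasDerivAt.fun_sum fun j _ => ?_
        rw [iteratedDeriv_succ]
        exact (((hball s hs).1 j).iteratedDeriv_of_complete k).differentiableAt.hasDerivAt.mul
          (ha_an s hs j).differentiableAt.hasDerivAt
      have h₂ : (fun r => ∑ j, iteratedDeriv (k : ℕ) (y j) r * a j r) =ᶠ[𝓝 s] fun _ => 0 :=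
        hmem.mono fun r hr => hsum r hr k.castSucc
      have h₃ := h₁.unique ((hasDerivAt_const s (0 : ℂ)).congr_of_eventuallyEq h₂)
      rw [Finset.sum_add_distrib] at h₃
      have h₄ := hsum s hs k.succ
      rw [Fin.val_succ] at h₄
      rwa [h₄, zero_add] at h₃
    have hzero : (fun j : Fin l => deriv (a j.castSucc) s) = 0 := by
      refine Matrix.eq_zero_of_mulVec_eq_zero
        (M := Matrix.of fun k j : Fin l => iteratedDeriv (k : ℕ) (y j.castSucc) s) ?_ ?_
      · have h := (hball s hs).2.2
        rwa [hv_last] at h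
      · ext k
        have h := hsum_deriv k
        rw [Fin.sum_univ_castSucc, hlast, mul_zero, add_zero] at h
        exact h
    intro j
    induction j using Fin.lastCases with
    | last => exact hlast
    | cast j => exact congrFun hzero j
  have ht : t ∈ Metric.ball t ε := Metric.mem_ball_self hε
  refine ⟨fun j => a j t, fun h => ?_, ?_⟩
  · have h₁ := congrFun h (Fin.last l)
    rw [ha_last t ht] at h₁
    exact one_ne_zero h₁
  · filter_upwards [Metric.isOpen_ball.mem_nhds ht] with s hs
    have hconst : ∀ j, a j t = a j s := fun j =>
      Metric.isOpen_ball.is_const_of_deriv_eq_zero (convex_ball t ε).isPreconnected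
        (fun r hr => (ha_an r hr j).differentiableAt.differentiableWithinAt)
        (fun r hr => ha_deriv r hr j) ht hs
    have h := hsum s hs 0
    simpa [hconst, mul_comm] using h

/-- Analytic functions on a connected open set whose Wronskian vanishes identically are
linearly dependent. -/
theorem exists_sum_eq_zero_of_wronskian_eq_zero {U : Set ℂ} (hU : IsOpen U)
    (hUc : IsConnected U) {l : ℕ} {y : Fin l → ℂ → ℂ} (hy : ∀ j, AnalyticOnNhd ℂ (y j) U)
    (hW : ∀ t ∈ U, wronskian y t = 0) :
    ∃ c : Fin l → ℂ, c ≠ 0 ∧ ∀ t ∈ U, ∑ j, c j * y j t = 0 := by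
  induction l with
  | zero =>
    obtain ⟨t, ht⟩ := hUc.nonempty
    simpa [wronskian] using hW t ht
  | succ l ih =>
    by_cases h : ∀ t ∈ U, wronskian (fun j : Fin l => y j.castSucc) t = 0
    · obtain ⟨c, hc, hsum⟩ := ih (fun j => hy j.castSucc) h
      refine ⟨Fin.snoc c 0, fun h₀ => hc ?_, fun t ht => ?_⟩
      · ext j
        simpa using congrFun h₀ j.castSucc
      · simpa [Fin.sum_univ_castSucc] using hsum t ht
    · push Not at h
      obtain ⟨t, ht, hne⟩ := h
      obtain ⟨c, hc, hsum⟩ := exists_eventually_sum_eq_zero_of_wronskian_castSucc_ne_zero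
        (fun j => hy j t ht) ((hU.eventually_mem ht).mono hW) hne
      refine ⟨c, hc, ?_⟩
      exact AnalyticOnNhd.eqOn_zero_of_preconnected_of_eventuallyEq_zero
        (fun s hs => Finset.analyticAt_fun_sum _ fun j _ => analyticAt_const.mul (hy j s hs))
        hUc.isPreconnected ht hsum

/-- Replacing the `j`-th function by a linear combination multiplies the Wronskian by the `j`-th
coefficient. -/
theorem det_updateCol_iteratedDeriv_sum {l : ℕ} {y : Fin l → ℂ → ℂ} {t : ℂ}
    (hy : ∀ j, AnalyticAt ℂ (y j) t) (c : Fin l → ℂ) (j : Fin l) :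
    ((Matrix.of fun k i : Fin l => iteratedDeriv (k : ℕ) (y i) t).updateCol j
      fun k => iteratedDeriv (k : ℕ) (fun s => ∑ i, c i * y i s) t).det =
      c j * wronskian y t := by
  have h : (fun k : Fin l => iteratedDeriv (k : ℕ) (fun s => ∑ i, c i * y i s) t) =
      fun k => ∑ i, c i • (Matrix.of fun k i : Fin l => iteratedDeriv (k : ℕ) (y i) t) k i := by
    ext k
    rw [iteratedDeriv_fun_sum (f := fun i s => c i * y i s)
      fun i _ => (analyticAt_const.mul (hy i)).contDiffAt]
    simp
  rw [h, Matrix.det_updateCol_sum]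
  rfl

theorem iteratedDeriv_eq_zero_of_lt_ordAt {f : ℂ → ℂ} {t : ℂ} {k : ℕ} (hk : k < ordAt f t) :
    iteratedDeriv k f t = 0 := by
  by_contra h
  exact Nat.notMem_of_lt_sInf hk h

/-- A function that is not identically zero near `t` vanishes to order at least `n` once it is
divisible by the `n`-th power of the coordinate. -/
theorem le_ordAt_of_eventually_eq_pow_smul {f g : ℂ → ℂ} {t : ℂ} {n : ℕ} (hf : AnalyticAt ℂ f t)
    (hf₀ : ¬ ∀ᶠ s in 𝓝 t, f s = 0) (hg : AnalyticAt ℂ g t)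
    (h : ∀ᶠ s in 𝓝 t, f s = (s - t) ^ n • g s) : n ≤ ordAt f t := by
  have hzero := (natCast_le_analyticOrderAt_iff_iteratedDeriv_eq_zero hf).1
    ((natCast_le_analyticOrderAt hf).2 ⟨g, hg, h⟩)
  refine le_csInf ?_ fun k hk => not_lt.1 fun hlt => hk (hzero k hlt)
  by_contra hempty
  refine hf₀ (analyticOrderAt_eq_top.1 (ENat.eq_top_iff_forall_ge.2 fun m => ?_))
  refine (natCast_le_analyticOrderAt_iff_iteratedDeriv_eq_zero hf).2 fun i _ => ?_
  by_contra hi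
  exact hempty ⟨i, hi⟩

/-- The derivative of order `k` of `f` is divisible by the `(ordAt f t - k)`-th power of the
coordinate. -/
theorem exists_iteratedDeriv_eq_pow_smul {f : ℂ → ℂ} {t : ℂ} (hf : AnalyticAt ℂ f t) {k n : ℕ}
    (hn : n + k ≤ ordAt f t) :
    ∃ g, AnalyticAt ℂ g t ∧ ∀ᶠ s in 𝓝 t, iteratedDeriv k f s = (s - t) ^ n • g s := by
  have hk := hf.iteratedDeriv_of_complete k
  refine (natCast_le_analyticOrderAt hk).1
    ((natCast_le_analyticOrderAt_iff_iteratedDeriv_eq_zero hk).2 fun i hi => ?_)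
  rw [iteratedDeriv_eq_iterate, iteratedDeriv_eq_iterate, ← Function.iterate_add_apply,
    ← iteratedDeriv_eq_iterate]
  exact iteratedDeriv_eq_zero_of_lt_ordAt (by lia)

/-- if `y₁, …, y_l` are analytic near `t₀` and linearly independent over `ℂ`,
then their Wronskian `W` is not identically zero near `t₀`, and every nonzero element `y`
of their `ℂ`-linear span satisfies `ord_{t₀} y ≤ l − 1 + ord_{t₀} W`. -/
theorem ord_le_of_mem_span_wronskian
    (t₀ : ℂ) (l : ℕ) (hl : 1 ≤ l) (y : Fin l → ℂ → ℂ)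
    (hy : ∀ j, AnalyticAt ℂ (y j) t₀)
    (hind : ∀ c : Fin l → ℂ, (∀ᶠ t in nhds t₀, ∑ j, c j * y j t = 0) → c = 0) :
    (¬ ∀ᶠ t in nhds t₀, wronskian y t = 0) ∧
      ∀ c : Fin l → ℂ, (¬ ∀ᶠ t in nhds t₀, ∑ j, c j * y j t = 0) →
        ordAt (fun t => ∑ j, c j * y j t) t₀ ≤ l - 1 + ordAt (wronskian y) t₀ := by
  have hW₀ : ¬ ∀ᶠ t in nhds t₀, wronskian y t = 0 := by
    intro hW
    obtain ⟨ε, hε, hball⟩ := Metric.eventually_nhds_iff_ball.1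
      ((eventually_all.2 fun j => (hy j).eventually_analyticAt).and hW)
    obtain ⟨c, hc, hsum⟩ := exists_sum_eq_zero_of_wronskian_eq_zero Metric.isOpen_ball
      ((convex_ball t₀ ε).isConnected ⟨t₀, Metric.mem_ball_self hε⟩)
      (fun j s hs => (hball s hs).1 j) fun s hs => (hball s hs).2
    exact hc (hind c (mem_of_superset (Metric.ball_mem_nhds t₀ hε) hsum))
  refine ⟨hW₀, fun c hc => ?_⟩
  set f : ℂ → ℂ := fun t => ∑ j, c j * y j t
  have hf : AnalyticAt ℂ f t₀ :=
    Finset.analyticAt_fun_sum _ fun j _ => analyticAt_const.mul (hy j)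
  obtain ⟨j, hj⟩ : ∃ j, c j ≠ 0 := by
    by_contra! h
    exact hc (by simp [h])
  rw [← Nat.sub_le_iff_le_add']
  rcases le_total (ordAt f t₀) (l - 1) with hle | hle
  · simp [Nat.sub_eq_zero_of_le hle]
  choose g hg hfg using fun k : Fin l =>
    exists_iteratedDeriv_eq_pow_smul hf (k := k) (n := ordAt f t₀ - (l - 1)) (by lia)
  set H : ℂ → ℂ := fun t => ((Matrix.of fun k i : Fin l =>
    iteratedDeriv (k : ℕ) (y i) t).updateCol j fun k => g k t).det
  have hH : AnalyticAt ℂ H t₀ := by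
    refine AnalyticAt.matrix_det fun k i => ?_
    by_cases h : i = j
    · simpa [Matrix.updateCol_apply, h] using hg k
    · simpa [Matrix.updateCol_apply, h] using (hy i).iteratedDeriv_of_complete k
  refine le_ordAt_of_eventually_eq_pow_smul (AnalyticAt.wronskian hy) hW₀
    (analyticAt_const (v := (c j)⁻¹) |>.mul hH) ?_
  filter_upwards [eventually_all.2 fun j => (hy j).eventually_analyticAt,
    eventually_all.2 hfg] with t hyt hfgt
  have hdet := det_updateCol_iteratedDeriv_sum hyt c j
  rw [show (fun k : Fin l => iteratedDeriv (k : ℕ) (fun s => ∑ i, c i * y i s) t) =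
    (t - t₀) ^ (ordAt f t₀ - (l - 1)) • fun k => g k t from funext hfgt,
    Matrix.det_updateCol_smul] at hdet
  rw [smul_eq_mul, Pi.mul_apply, mul_left_comm, hdet, inv_mul_cancel_left₀ hj]
end

section
/- Let n ≥ 1 and let H = y² − x^{n+1} + H̄(x) be a hyperelliptic polynomial, where H̄ ∈ ℂ[x] has degree ≤ n−1. Then there exist complex constants a_{ij}, b_{ij} (1 ≤ i, j ≤ n) and polynomials f_1, …, f_n ∈ ℂ[x,y] such that, for each i = 1, …, n, the identity of polynomial 2-forms H·dω_i = dH ∧ ( Σ_{j=1}^{n} b_{ij} ω_j + df_i ) + Σ_{j=1}^{n} a_{ij} dω_j holds, where ω_j = x^{j−1} y dx; equivalently, for each i the polynomial identity H(x,y)·x^{i−1} = Σ_{j=1}^{n} a_{ij} x^{j−1} + 2y²·Σ_{j=1}^{n} b_{ij} x^{j−1} + ( ∂H/∂y · ∂f_i/∂x − ∂H/∂x · ∂f_i/∂y ) holds in ℂ[x,y]. -/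
open scoped BigOperators
open MvPolynomial

/-- The hyperelliptic polynomial `H = y² − x^{n+1} + H̄(x)` as an element of `ℂ[x,y]`,
with `x = X 0` and `y = X 1`. -/
noncomputable def hypH (n : ℕ) (Hbar : Polynomial ℂ) : MvPolynomial (Fin 2) ℂ :=
  X 1 ^ 2 - X 0 ^ (n + 1) + Polynomial.aeval (X 0) Hbar

open Polynomial in
/-- A polynomial in `X k` of degree less than `n`, written out in the powers `X k ^ j`. -/
theorem aeval_X_eq_sum_fin {σ R : Type*} [CommSemiring R] (k : σ) {p : R[X]} {n : ℕ}
    (hp : p.natDegree < n) :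
    aeval (MvPolynomial.X k : MvPolynomial σ R) p =
      ∑ j : Fin n, MvPolynomial.C (p.coeff j) * MvPolynomial.X k ^ (j : ℕ) := by
  rw [aeval_eq_sum_range' hp, Finset.sum_range]
  simp [MvPolynomial.smul_eq_C_mul]

theorem pderiv_aeval_X {σ R : Type*} [CommSemiring R] (k : σ) (p : Polynomial R) :
    pderiv k (Polynomial.aeval (X k : MvPolynomial σ R) p) =
      Polynomial.aeval (X k) (Polynomial.derivative p) := by
  rw [Derivation.map_aeval, pderiv_X_self, smul_eq_mul, mul_one]

theorem pderiv_aeval_X_of_ne {σ R : Type*} [CommSemiring R] {k l : σ} (h : k ≠ l)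
    (p : Polynomial R) : pderiv l (Polynomial.aeval (X k : MvPolynomial σ R) p) = 0 := by
  rw [Derivation.map_aeval, pderiv_X_of_ne h, smul_zero]

theorem hypH_eq (n : ℕ) (Hbar : Polynomial ℂ) :
    hypH n Hbar = X 1 ^ 2 + Polynomial.aeval (X 0) (Hbar - Polynomial.X ^ (n + 1)) := by
  simp only [hypH, map_sub, map_pow, Polynomial.aeval_X]
  ring

open Polynomial in
/-- Division of `h * X ^ i` by the derivative of `h`, with the degrees of quotient and remainder. -/
theorem exists_mul_X_pow_eq_sub_derivative_mul {K : Type*} [Field K] [CharZero K] {n : ℕ}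
    (hn : 1 ≤ n) {h : K[X]} (hh : h.natDegree = n + 1) (i : ℕ) :
    ∃ A r : K[X], A.natDegree < n ∧ r.natDegree ≤ i + 1 ∧
      h * Polynomial.X ^ i = A - derivative h * r := by
  have hd : (derivative h).natDegree = n := by
    rw [natDegree_derivative, hh, Nat.add_sub_cancel]
  refine ⟨h * Polynomial.X ^ i % derivative h, -(h * Polynomial.X ^ i / derivative h), ?_, ?_, ?_⟩
  · have := natDegree_mod_lt (h * Polynomial.X ^ i) (q := derivative h) (by lia)
    rwa [hd] at this
  · have h_ne : h ≠ 0 := by rintro rfl; simp at hh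
    have hd_ne : derivative h ≠ 0 := by intro h₀; simp [h₀] at hd; lia
    have hm : (h * Polynomial.X ^ i).natDegree = n + 1 + i := by
      rw [natDegree_mul h_ne (by simp), hh, natDegree_X_pow]
    have hm_ne : h * Polynomial.X ^ i ≠ 0 := mul_ne_zero h_ne (by simp)
    rw [natDegree_neg]
    by_cases hq : h * Polynomial.X ^ i / derivative h = 0
    · simp [hq]
    · have := degree_add_div hd_ne (p := h * Polynomial.X ^ i)
        (degree_lt_degree (by lia)).le
      rw [degree_eq_natDegree hd_ne, degree_eq_natDegree hm_ne, degree_eq_natDegree hq, hd,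
        hm] at this
      norm_cast at this
      lia
  · rw [mul_neg, sub_neg_eq_add, EuclideanDomain.mod_add_div]

/-- for a hyperelliptic polynomial `H = y² − x^{n+1} + H̄(x)` there are
constants `a_{ij}, b_{ij}` and polynomials `f_i` such that the identities of 2-forms
`H·dω_i = dH ∧ (∑_j b_{ij} ω_j + df_i) + ∑_j a_{ij} dω_j` hold, equivalently the
polynomial identities
`H·x^{i−1} = ∑_j a_{ij} x^{j−1} + 2y²·∑_j b_{ij} x^{j−1} + (H_y·(f_i)_x − H_x·(f_i)_y)`. -/
theorem exists_petrov_decomposition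
    (n : ℕ) (hn : 1 ≤ n) (Hbar : Polynomial ℂ) (hHdeg : Hbar.natDegree ≤ n - 1) :
    ∃ (a b : Fin n → Fin n → ℂ) (f : Fin n → MvPolynomial (Fin 2) ℂ),
      ∀ i : Fin n,
        hypH n Hbar * X 0 ^ (i : ℕ)
          = (∑ j : Fin n, C (a i j) * X 0 ^ (j : ℕ))
            + 2 * X 1 ^ 2 * (∑ j : Fin n, C (b i j) * X 0 ^ (j : ℕ))
            + (pderiv 1 (hypH n Hbar) * pderiv 0 (f i)
                - pderiv 0 (hypH n Hbar) * pderiv 1 (f i)) := by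
  set h : Polynomial ℂ := Hbar - Polynomial.X ^ (n + 1) with hh
  have hdeg : h.natDegree = n + 1 := by
    rw [hh, Polynomial.natDegree_sub_eq_right_of_natDegree_lt] <;>
      rw [Polynomial.natDegree_X_pow]
    lia
  choose A r hA hr hAr using exists_mul_X_pow_eq_sub_derivative_mul hn hdeg
  let B (i : ℕ) : Polynomial ℂ :=
    Polynomial.C (1 / 2) * Polynomial.X ^ i - Polynomial.derivative (r i)
  have hB (i : Fin n) : (B i).natDegree < n := by
    have h₁ : (Polynomial.C (1 / 2 : ℂ) * Polynomial.X ^ (i : ℕ)).natDegree ≤ (i : ℕ) :=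
      Polynomial.natDegree_C_mul_X_pow_le _ _
    have h₂ := Polynomial.natDegree_derivative_le (r i)
    have h₃ := hr i
    have h₄ := Polynomial.natDegree_sub_le_of_le h₁ (h₂.trans (Nat.sub_le_sub_right h₃ 1))
    exact h₄.trans_lt (by simp)
  refine ⟨fun i j => (A i).coeff j, fun i j => (B i).coeff j,
    fun i => X 1 * Polynomial.aeval (X 0) (r i), fun i => ?_⟩
  rw [← aeval_X_eq_sum_fin 0 (hA i), ← aeval_X_eq_sum_fin 0 (hB i), hypH_eq, ← hh]
  have key := congrArg (Polynomial.aeval (X 0 : MvPolynomial (Fin 2) ℂ)) (hAr i)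
  simp only [map_mul, map_sub, map_pow, Polynomial.aeval_X] at key
  have half : (2 : MvPolynomial (Fin 2) ℂ) * C (1 / 2) = 1 := by
    rw [← map_ofNat C 2, ← C_mul]
    norm_num
  simp only [B, map_add, map_sub, map_mul, map_pow, Polynomial.aeval_X, Polynomial.aeval_C,
    algebraMap_eq, Derivation.leibniz, Derivation.leibniz_pow, pderiv_aeval_X,
    pderiv_aeval_X_of_ne (zero_ne_one : (0 : Fin 2) ≠ 1), pderiv_X_self,
    pderiv_X_of_ne (one_ne_zero : (1 : Fin 2) ≠ 0), smul_eq_mul, nsmul_eq_mul]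
  push_cast
  linear_combination key - X 1 ^ 2 * X 0 ^ (i : ℕ) * half
end

section
/- Let n ≥ 1, H = y² − x^{n+1} + H̄(x) with H̄ ∈ ℂ[x] of degree ≤ n−1, and suppose a_{ij}, b_{ij} ∈ ℂ and f_i ∈ ℂ[x,y] satisfy, for each i = 1, …, n, the identity H(x,y)·x^{i−1} = Σ_{j=1}^{n} a_{ij} x^{j−1} + 2y²·Σ_{j=1}^{n} b_{ij} x^{j−1} + ( ∂H/∂y · ∂f_i/∂x − ∂H/∂x · ∂f_i/∂y ) in ℂ[x,y]. Let (x_0, y_0) be a critical point of H, i.e. ∂H/∂x(x_0,y_0) = ∂H/∂y(x_0,y_0) = 0, and set t_* = H(x_0, y_0). Then y_0 = 0 and Σ_{j=1}^{n} a_{ij} x_0^{j−1} = t_*·x_0^{i−1} for every i; in particular, the nonzero vector v = (1, x_0, x_0², …, x_0^{n−1}) satisfies A·v = t_*·v for A = (a_{ij}), so the critical value t_* is an eigenvalue of the matrix A. -/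
open scoped BigOperators
open MvPolynomial

theorem pderiv_one_hypH (n : ℕ) (Hbar : Polynomial ℂ) :
    pderiv 1 (hypH n Hbar) = 2 * X 1 := by
  have h : pderiv (1 : Fin 2) (X 0 : MvPolynomial (Fin 2) ℂ) = 0 :=
    pderiv_X_of_ne (by decide)
  simp [hypH, Derivation.map_aeval, Derivation.leibniz_pow, h]

/-- given the Petrov decomposition identities for `H = y² − x^{n+1} + H̄(x)`
and a critical point `(x₀, y₀)` of `H` with critical value `t_* = H(x₀,y₀)`, one has
`y₀ = 0`, `∑_j a_{ij} x₀^{j−1} = t_*·x₀^{i−1}` for all `i`, and the nonzero vector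
`v = (1, x₀, …, x₀^{n−1})` satisfies `A·v = t_*·v`, so `t_*` is an eigenvalue of `A`. -/
theorem critical_value_is_eigenvalue
    (n : ℕ) (hn : 1 ≤ n) (Hbar : Polynomial ℂ) (hHdeg : Hbar.natDegree ≤ n - 1)
    (a b : Fin n → Fin n → ℂ) (f : Fin n → MvPolynomial (Fin 2) ℂ)
    (hid : ∀ i : Fin n,
      hypH n Hbar * X 0 ^ (i : ℕ)
        = (∑ j : Fin n, C (a i j) * X 0 ^ (j : ℕ))
          + 2 * X 1 ^ 2 * (∑ j : Fin n, C (b i j) * X 0 ^ (j : ℕ))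
          + (pderiv 1 (hypH n Hbar) * pderiv 0 (f i)
              - pderiv 0 (hypH n Hbar) * pderiv 1 (f i)))
    (x₀ y₀ : ℂ)
    (hcx : eval ![x₀, y₀] (pderiv 0 (hypH n Hbar)) = 0)
    (hcy : eval ![x₀, y₀] (pderiv 1 (hypH n Hbar)) = 0) :
    y₀ = 0 ∧
    (∀ i : Fin n, ∑ j : Fin n, a i j * x₀ ^ (j : ℕ)
        = eval ![x₀, y₀] (hypH n Hbar) * x₀ ^ (i : ℕ)) ∧
    (fun j : Fin n => x₀ ^ (j : ℕ)) ≠ 0 ∧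
    (Matrix.of a).mulVec (fun j : Fin n => x₀ ^ (j : ℕ))
      = eval ![x₀, y₀] (hypH n Hbar) • fun j : Fin n => x₀ ^ (j : ℕ) := by
  have hy : y₀ = 0 := by
    simpa [pderiv_one_hypH] using hcy
  have hA : ∀ i : Fin n, ∑ j : Fin n, a i j * x₀ ^ (j : ℕ)
      = eval ![x₀, y₀] (hypH n Hbar) * x₀ ^ (i : ℕ) := by
    intro i
    have h := congrArg (eval ![x₀, y₀]) (hid i)
    simp only [map_add, map_sub, map_mul, map_pow, map_sum, hcx, hcy, eval_X, eval_C] at h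
    simpa [hy] using h.symm
  refine ⟨hy, hA, fun h => ?_, ?_⟩
  · simpa using congrFun h ⟨0, hn⟩
  · ext i
    simpa [Matrix.mulVec, dotProduct] using hA i
end

section
/- Let n ≥ 1 and let H = y² − x^{n+1} + H̄(x) be a hyperelliptic polynomial of Morse type, with H̄ ∈ ℂ[x] of degree ≤ n−1: setting p(x) = x^{n+1} − H̄(x), the derivative p′ has n pairwise distinct roots x_1, …, x_n and the critical values t_k := −p(x_k) = H(x_k, 0) are pairwise distinct. Suppose a_{ij}, b_{ij} ∈ ℂ and f_i ∈ ℂ[x,y] satisfy, for each i = 1, …, n, the identity H(x,y)·x^{i−1} = Σ_{j=1}^{n} a_{ij} x^{j−1} + 2y²·Σ_{j=1}^{n} b_{ij} x^{j−1} + ( ∂H/∂y · ∂f_i/∂x − ∂H/∂x · ∂f_i/∂y ) in ℂ[x,y]. Then the characteristic polynomial of the matrix A = (a_{ij}) is det(t·E − A) = (t − t_1)(t − t_2)⋯(t − t_n), where E is the n×n identity matrix. -/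
open scoped BigOperators
open MvPolynomial

theorem eval_hypH (n : ℕ) (Hbar : Polynomial ℂ) (z : ℂ) :
    eval ![z, 0] (hypH n Hbar) = -(Polynomial.X ^ (n + 1) - Hbar).eval z := by
  have h : eval ![z, 0] (Polynomial.aeval (X 0 : MvPolynomial (Fin 2) ℂ) Hbar) = Hbar.eval z := by
    rw [← coe_aeval_eq_eval, RingHom.coe_coe, ← Polynomial.aeval_algHom_apply]
    simp
  simp [hypH, h, neg_add_eq_sub]

theorem eval_pderiv_zero_hypH (n : ℕ) (Hbar : Polynomial ℂ) (z : ℂ) :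
    eval ![z, 0] (pderiv 0 (hypH n Hbar)) =
      -(Polynomial.derivative (Polynomial.X ^ (n + 1) - Hbar)).eval z := by
  have h : eval ![z, 0] (Polynomial.aeval (X 0 : MvPolynomial (Fin 2) ℂ)
      (Polynomial.derivative Hbar)) = (Polynomial.derivative Hbar).eval z := by
    rw [← coe_aeval_eq_eval, RingHom.coe_coe, ← Polynomial.aeval_algHom_apply]
    simp
  simp [hypH, Derivation.map_aeval, Derivation.leibniz_pow, h, neg_add_eq_sub]

theorem eval_pderiv_one_hypH (n : ℕ) (Hbar : Polynomial ℂ) (z : ℂ) :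
    eval ![z, 0] (pderiv 1 (hypH n Hbar)) = 0 := by
  simp [hypH, Derivation.map_aeval, Derivation.leibniz_pow]

/-- If the rows of a Vandermonde matrix with pairwise distinct nodes are eigenvectors of `A` with
eigenvalues `t k`, then the characteristic polynomial of `A` is `∏ k, (X - t k)`. -/
theorem charpoly_eq_prod_of_vandermonde {K : Type*} [Field K] {n : ℕ} {A : Matrix (Fin n) (Fin n) K}
    {x t : Fin n → K} (hx : Function.Injective x)
    (h : ∀ k (i : Fin n), t k * x k ^ (i : ℕ) = ∑ j : Fin n, A i j * x k ^ (j : ℕ)) :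
    A.charpoly = ∏ k : Fin n, (Polynomial.X - Polynomial.C (t k)) := by
  have hV : IsUnit (Matrix.vandermonde x) := by
    rw [Matrix.isUnit_iff_isUnit_det, isUnit_iff_ne_zero]
    exact Matrix.det_vandermonde_ne_zero_iff.mpr hx
  obtain ⟨V, hV⟩ := hV
  have hconj : V.val * A.transpose = Matrix.diagonal t * V.val := by
    ext k i
    rw [Matrix.diagonal_mul, hV, Matrix.mul_apply, Matrix.vandermonde_apply, h]
    exact Finset.sum_congr rfl fun j _ => mul_comm _ _
  rw [← Matrix.charpoly_transpose, ← Matrix.charpoly_units_conj V, hconj,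
    ← Matrix.coe_units_inv, Units.mul_inv_cancel_right, Matrix.charpoly_diagonal]

/-- for a Morse-type hyperelliptic polynomial `H = y² − x^{n+1} + H̄(x)`
(with `p = x^{n+1} − H̄`, `p′` having `n` distinct roots `x_k` and the critical values
`t_k = −p(x_k)` pairwise distinct), the matrix `A = (a_{ij})` of the Petrov decomposition
satisfies `det(t·E − A) = (t − t₁)⋯(t − t_n)`. -/
theorem charpoly_eq_prod_critical_values
    (n : ℕ) (hn : 1 ≤ n) (Hbar : Polynomial ℂ) (hHdeg : Hbar.natDegree ≤ n - 1)
    (xs : Fin n → ℂ) (hxs : Function.Injective xs)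
    (hroots : ∀ k, (Polynomial.derivative (Polynomial.X ^ (n + 1) - Hbar)).eval (xs k) = 0)
    (tv : Fin n → ℂ)
    (htv : ∀ k, tv k = -((Polynomial.X ^ (n + 1) - Hbar).eval (xs k)))
    (htvd : Function.Injective tv)
    (a b : Fin n → Fin n → ℂ) (f : Fin n → MvPolynomial (Fin 2) ℂ)
    (hid : ∀ i : Fin n,
      hypH n Hbar * X 0 ^ (i : ℕ)
        = (∑ j : Fin n, C (a i j) * X 0 ^ (j : ℕ))
          + 2 * X 1 ^ 2 * (∑ j : Fin n, C (b i j) * X 0 ^ (j : ℕ))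
          + (pderiv 1 (hypH n Hbar) * pderiv 0 (f i)
              - pderiv 0 (hypH n Hbar) * pderiv 1 (f i))) :
    (Matrix.of a).charpoly = ∏ k : Fin n, (Polynomial.X - Polynomial.C (tv k)) := by
  refine charpoly_eq_prod_of_vandermonde hxs fun k i => ?_
  have hcrit : eval ![xs k, 0] (pderiv 0 (hypH n Hbar)) = 0 := by
    rw [eval_pderiv_zero_hypH, hroots, neg_zero]
  have hval : eval ![xs k, 0] (hypH n Hbar) = tv k := by
    rw [eval_hypH, htv]
  simpa [hcrit, hval, eval_pderiv_one_hypH] using congrArg (eval ![xs k, 0]) (hid i)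
end
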